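/- Let $(M,g)$ be a smooth Riemannian manifold (without boundary) of dimension $n\ge 3$, with Levi-Civita connection $\nabla$. For $x\in M$, $y\in T_xM$ and $X\in T_xM$ let $X^h$ and $X^v$ in $T_{(x,y)}TM$ be the horizontal lift (with respect to $\nabla$) and the vertical lift of $X$. Let $a,b,c\in\mathbb R$ with $a>0$ and $\alpha:=a(a+c)-b^2>0$, and let $G=a\,g^s+b\,g^h+c\,g^v$ be the $g$-natural Riemannian metric on $TM$ given by $$G(X^h,Y^h)=(a+c)\,g(X,Y),\quad G(X^h,Y^v)=G(X^v,Y^h)=b\,g(X,Y),\quad G(X^v,Y^v)=a\,g(X,Y).$$ A Riemannian manifold $(N,h)$ with Levi-Civita connection $\nabla$ and curvature tensor $R(X,Y)Z=\nabla_X\nabla_YZ-\nabla_Y\nabla_XZ-\nabla_{[X,Y]}Z$ is called flat if $R\equiv 0$, and weakly symmetric if there are smooth 1-forms $\alpha_1,\alpha_2$ on $N$ such that $$(\nabla_WR)(X,Y)Z=\alpha_1(W)R(X,Y)Z+\alpha_2(X)R(W,Y)Z+\alpha_2(Y)R(X,W)Z+\alpha_2(Z)R(X,Y)W+h(R(X,Y)Z,W)\,\alpha_2^\sharp$$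 for all vector fields $X,Y,Z,W$, where $\alpha_2^\sharp$ is the vector field $h$-dual to $\alpha_2$. Then $(TM,G)$ is weakly symmetric if and only if $(M,g)$ is flat; moreover, in this case $(TM,G)$ is flat. -/

import Mathlib

set_option maxSynthPendingDepth 3

open scoped Manifold ContDiff Bundle

noncomputable section

namespace NatMetric

/-! ### Riemannian calculus in a coordinate domain

`h : E → E →L[ℝ] E →L[ℝ] ℝ` is the field of coefficients of a metric in a chart with values in the
finite-dimensional space `E`; vectors of `E` are also regarded as the vector fields with constant
coefficients (linear combinations of the coordinate fields). -/

section Coordinates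

variable {E : Type*} [NormedAddCommGroup E] [NormedSpace ℝ E]

/-- The Christoffel symbol of the first kind,
`(v, w) ↦ (z ↦ (∂_v h(w, z) + ∂_w h(v, z) - ∂_z h(v, w)) / 2)` at the point `u`. -/
def christoffelFirst (h : E → E →L[ℝ] E →L[ℝ] ℝ) (u : E) : E →L[ℝ] E →L[ℝ] (E →L[ℝ] ℝ) :=
  (1 / 2 : ℝ) • (fderiv ℝ h u + (fderiv ℝ h u).flip
    - (ContinuousLinearMap.flipₗᵢ ℝ E E ℝ : (E →L[ℝ] E →L[ℝ] ℝ) →L[ℝ] (E →L[ℝ] E →L[ℝ] ℝ)) ∘L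
      (fderiv ℝ h u).flip)

theorem christoffelFirst_apply (h : E → E →L[ℝ] E →L[ℝ] ℝ) (u v w z : E) :
    christoffelFirst h u v w z
      = (1 / 2) * (fderiv ℝ h u v w z + fderiv ℝ h u w v z - fderiv ℝ h u z v w) := by
  simp [christoffelFirst]

/-- The Christoffel symbol of the second kind `Γ(v, w) = ∇_v w` at `u`: the index of
`christoffelFirst` is raised with the inverse of `h u : E →L[ℝ] (E →L[ℝ] ℝ)`, so that
`h(Γ(v, w), z) = christoffelFirst h u v w z`. -/
def christoffel (h : E → E →L[ℝ] E →L[ℝ] ℝ) (u : E) : E →L[ℝ] E →L[ℝ] E :=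
  (ContinuousLinearMap.compL ℝ E (E →L[ℝ] ℝ) E (h u).inverse) ∘L (christoffelFirst h u)

theorem christoffel_apply (h : E → E →L[ℝ] E →L[ℝ] ℝ) (u v w : E) :
    christoffel h u v w = (h u).inverse (christoffelFirst h u v w) := rfl

/-- The curvature `R(X, Y)Z = ∇_X ∇_Y Z - ∇_Y ∇_X Z` at `u` for the fields with constant
coefficients `X, Y, Z` (for which `[X, Y] = 0`). -/
def coordCurvature (h : E → E →L[ℝ] E →L[ℝ] ℝ) (u X Y Z : E) : E :=
  (fderiv ℝ (fun u' => christoffel h u' Y Z) u X + christoffel h u X (christoffel h u Y Z))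
    - (fderiv ℝ (fun u' => christoffel h u' X Z) u Y + christoffel h u Y (christoffel h u X Z))

/-- The covariant derivative of the curvature
`(∇_W R)(X, Y)Z = ∇_W (R(X, Y)Z) - R(∇_W X, Y)Z - R(X, ∇_W Y)Z - R(X, Y)∇_W Z`
at `u`, for the fields with constant coefficients `W, X, Y, Z`. -/
def coordCovDerivCurvature (h : E → E →L[ℝ] E →L[ℝ] ℝ) (u W X Y Z : E) : E :=
  (fderiv ℝ (fun u' => coordCurvature h u' X Y Z) u W
      + christoffel h u W (coordCurvature h u X Y Z))
    - coordCurvature h u (christoffel h u W X) Y Z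
    - coordCurvature h u X (christoffel h u W Y) Z
    - coordCurvature h u X Y (christoffel h u W Z)

end Coordinates

/-! ### Curvature of a metric on a manifold (without boundary) -/

section Manifold

variable {E : Type*} [NormedAddCommGroup E] [NormedSpace ℝ E]
  {H : Type*} [TopologicalSpace H] {I : ModelWithCorners ℝ E H}
  {N : Type*} [TopologicalSpace N] [ChartedSpace H N]

/-- The coefficients of the metric `h` in the chart at `x₀`: at the coordinate point `u` the value
on `v, w` is `h(∂_v, ∂_w)`, where `∂_v` is the image of `v` under the differential of the inverse
of the chart. -/
def chartMetric (h : ∀ x : N, TangentSpace I x →L[ℝ] TangentSpace I x →L[ℝ] ℝ) (x₀ : N) :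
    E → E →L[ℝ] E →L[ℝ] ℝ := fun u =>
  let T : E →L[ℝ] E := mfderivWithin 𝓘(ℝ, E) I (extChartAt I x₀).symm (Set.range I) u
  let B : E →L[ℝ] E →L[ℝ] ℝ := h ((extChartAt I x₀).symm u)
  B.bilinearComp T T

/-- The Riemann curvature tensor `R(X, Y)Z` at `x`, computed in the chart at `x`. In Mathlib the
tangent space at `x` is the model space `E`, a tangent vector being given by its components in
the chart at `x`. -/
def curvature (h : ∀ x : N, TangentSpace I x →L[ℝ] TangentSpace I x →L[ℝ] ℝ) (x : N)
    (X Y Z : TangentSpace I x) : TangentSpace I x :=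
  coordCurvature (E := E) (chartMetric h x) (extChartAt I x x) X Y Z

/-- The covariant derivative `(∇_W R)(X, Y)Z` of the curvature tensor at `x`, computed in the
chart at `x`. -/
def covDerivCurvature (h : ∀ x : N, TangentSpace I x →L[ℝ] TangentSpace I x →L[ℝ] ℝ) (x : N)
    (W X Y Z : TangentSpace I x) : TangentSpace I x :=
  coordCovDerivCurvature (E := E) (chartMetric h x) (extChartAt I x x) W X Y Z

/-- The metric `h` is flat: its curvature tensor vanishes identically. -/
def IsFlat (h : ∀ x : N, TangentSpace I x →L[ℝ] TangentSpace I x →L[ℝ] ℝ) : Prop :=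
  ∀ (x : N) (X Y Z : TangentSpace I x), curvature h x X Y Z = 0

/-- A smooth 1-form on `N`. -/
def IsSmoothOneForm [IsManifold I ∞ N] (θ : ∀ x : N, TangentSpace I x →L[ℝ] ℝ) : Prop :=
  ContMDiff I (I.prod 𝓘(ℝ, E →L[ℝ] ℝ)) ∞
    (fun x => Bundle.TotalSpace.mk' (E →L[ℝ] ℝ)
      (E := fun x : N => TangentSpace I x →L[ℝ] ℝ) x (θ x))

/-- The vector `θ^♯` that is `h`-dual to the covector `θ`, i.e. `h(θ^♯, ·) = θ`. -/
def sharp (h : ∀ x : N, TangentSpace I x →L[ℝ] TangentSpace I x →L[ℝ] ℝ) (x : N)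
    (θ : TangentSpace I x →L[ℝ] ℝ) : TangentSpace I x :=
  (h x).inverse θ

/-- The Riemannian manifold `(N, h)` is weakly symmetric. -/
def IsWeaklySymmetric [IsManifold I ∞ N]
    (h : ∀ x : N, TangentSpace I x →L[ℝ] TangentSpace I x →L[ℝ] ℝ) : Prop :=
  ∃ α₁ α₂ : ∀ x : N, TangentSpace I x →L[ℝ] ℝ,
    IsSmoothOneForm α₁ ∧ IsSmoothOneForm α₂ ∧
    ∀ (x : N) (W X Y Z : TangentSpace I x),
      covDerivCurvature h x W X Y Z
        = α₁ x W • curvature h x X Y Z + α₂ x X • curvature h x W Y Z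
          + α₂ x Y • curvature h x X W Z + α₂ x Z • curvature h x X Y W
          + h x (curvature h x X Y Z) W • sharp h x (α₂ x)

end Manifold

/-! ### The metrics `a gˢ + b gʰ + c gᵛ` on the tangent bundle -/

section TangentBundle

variable {E : Type*} [NormedAddCommGroup E] [NormedSpace ℝ E]
  {H : Type*} [TopologicalSpace H] {I : ModelWithCorners ℝ E H}
  {M : Type*} [TopologicalSpace M] [ChartedSpace H M] [IsManifold I 1 M]

/-- The Christoffel symbols of `g` at `x` in the chart at `x`. -/
def christoffelAt (g : ∀ x : M, TangentSpace I x →L[ℝ] TangentSpace I x →L[ℝ] ℝ) (x : M) :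
    E →L[ℝ] E →L[ℝ] E :=
  christoffel (chartMetric g x) (extChartAt I x x)

/-- The differential `π_*` of the projection `π : TM → M` at `p`. The chart of `TM` at `p = (x, y)`
is the one induced by the chart of `M` at `x`, so the tangent space of `TM` at `p` is `E × E` with
coordinates `(dxⁱ, dyⁱ)`. -/
def projDiff (p : TangentBundle I M) :
    TangentSpace I.tangent p →L[ℝ] TangentSpace I p.proj :=
  (ContinuousLinearMap.fst ℝ E E : E × E →L[ℝ] E)

/-- The connection map `K` of the Levi-Civita connection at `p = (x, y)`, in coordinates
`Kᵏ = dyᵏ + Γᵏ_{ij} yʲ dxⁱ`. Its kernel is the horizontal space at `p`. -/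
def connMap (g : ∀ x : M, TangentSpace I x →L[ℝ] TangentSpace I x →L[ℝ] ℝ)
    (p : TangentBundle I M) : TangentSpace I.tangent p →L[ℝ] TangentSpace I p.proj :=
  (ContinuousLinearMap.snd ℝ E E
    + ((christoffelAt g p.proj).flip p.2) ∘L ContinuousLinearMap.fst ℝ E E : E × E →L[ℝ] E)

/-- The horizontal lift `Xⁱ (∂/∂xⁱ - yᵃ Γʲ_{ai} ∂/∂yʲ)` to `p = (x, y)` of a vector `X` at `x`. -/
def hlift (g : ∀ x : M, TangentSpace I x →L[ℝ] TangentSpace I x →L[ℝ] ℝ)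
    (p : TangentBundle I M) (X : TangentSpace I p.proj) : TangentSpace I.tangent p :=
  ((X, -christoffelAt g p.proj X p.2) : E × E)

/-- The vertical lift `Xⁱ ∂/∂yⁱ` to `p = (x, y)` of a vector `X` at `x`. -/
def vlift (p : TangentBundle I M) (X : TangentSpace I p.proj) : TangentSpace I.tangent p :=
  ((0, X) : E × E)

/-- The bilinear form `(ξ, η) ↦ g(S ξ, T η)` on the tangent space of `TM` at `p`, for linear maps
`S, T` from there to the tangent space of `M` at `π p`. -/
def pullForm (g : ∀ x : M, TangentSpace I x →L[ℝ] TangentSpace I x →L[ℝ] ℝ)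
    (p : TangentBundle I M) (S T : TangentSpace I.tangent p →L[ℝ] TangentSpace I p.proj) :
    TangentSpace I.tangent p →L[ℝ] TangentSpace I.tangent p →L[ℝ] ℝ :=
  ContinuousLinearMap.bilinearComp (E := E) (F := E) (G := ℝ) (E' := E × E) (F' := E × E)
    (g p.proj) S T

/-- The Sasaki lift `gˢ`. -/
def sasakiLift (g : ∀ x : M, TangentSpace I x →L[ℝ] TangentSpace I x →L[ℝ] ℝ)
    (p : TangentBundle I M) :
    TangentSpace I.tangent p →L[ℝ] TangentSpace I.tangent p →L[ℝ] ℝ :=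
  pullForm g p (projDiff p) (projDiff p)
    + pullForm g p (connMap g p) (connMap g p)

/-- The horizontal lift `gʰ` of the metric. -/
def horizontalLift (g : ∀ x : M, TangentSpace I x →L[ℝ] TangentSpace I x →L[ℝ] ℝ)
    (p : TangentBundle I M) :
    TangentSpace I.tangent p →L[ℝ] TangentSpace I.tangent p →L[ℝ] ℝ :=
  pullForm g p (projDiff p) (connMap g p)
    + pullForm g p (connMap g p) (projDiff p)

/-- The vertical lift `gᵛ` of the metric. -/
def verticalLift (g : ∀ x : M, TangentSpace I x →L[ℝ] TangentSpace I x →L[ℝ] ℝ)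
    (p : TangentBundle I M) :
    TangentSpace I.tangent p →L[ℝ] TangentSpace I.tangent p →L[ℝ] ℝ :=
  pullForm g p (projDiff p) (projDiff p)

/-- The metric `G = a gˢ + b gʰ + c gᵛ` on `TM`. -/
def natMetric (g : ∀ x : M, TangentSpace I x →L[ℝ] TangentSpace I x →L[ℝ] ℝ) (a b c : ℝ)
    (p : TangentBundle I M) :
    TangentSpace I.tangent p →L[ℝ] TangentSpace I.tangent p →L[ℝ] ℝ :=
  a • sasakiLift g p + b • horizontalLift g p + c • verticalLift g p

section Lifts

variable (g : ∀ x : M, TangentSpace I x →L[ℝ] TangentSpace I x →L[ℝ] ℝ) (a b c : ℝ)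
  (p : TangentBundle I M) (X Y : TangentSpace I p.proj)

theorem projDiff_hlift : projDiff p (hlift g p X) = X := rfl

theorem projDiff_vlift : projDiff p (vlift p X) = 0 := rfl

theorem connMap_hlift : connMap g p (hlift g p X) = 0 :=
  neg_add_cancel (christoffelAt g p.proj X p.2)

theorem connMap_vlift : connMap g p (vlift p X) = X := by
  change (show E from X) + christoffelAt g p.proj 0 p.2 = X
  rw [map_zero]
  exact add_zero _

theorem natMetric_apply (ξ η : TangentSpace I.tangent p) :
    natMetric g a b c p ξ η
      = a * (g p.proj (projDiff p ξ) (projDiff p η) + g p.proj (connMap g p ξ) (connMap g p η))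
        + b * (g p.proj (projDiff p ξ) (connMap g p η) + g p.proj (connMap g p ξ) (projDiff p η))
        + c * g p.proj (projDiff p ξ) (projDiff p η) := rfl

theorem natMetric_hlift_hlift :
    natMetric g a b c p (hlift g p X) (hlift g p Y) = (a + c) * g p.proj X Y := by
  rw [natMetric_apply]; simp [projDiff_hlift, connMap_hlift]; ring

theorem natMetric_hlift_vlift :
    natMetric g a b c p (hlift g p X) (vlift p Y) = b * g p.proj X Y := by
  rw [natMetric_apply]; simp [projDiff_hlift, connMap_hlift, projDiff_vlift, connMap_vlift]

theorem natMetric_vlift_hlift :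
    natMetric g a b c p (vlift p X) (hlift g p Y) = b * g p.proj X Y := by
  rw [natMetric_apply]; simp [projDiff_hlift, connMap_hlift, projDiff_vlift, connMap_vlift]

theorem natMetric_vlift_vlift :
    natMetric g a b c p (vlift p X) (vlift p Y) = a * g p.proj X Y := by
  rw [natMetric_apply]; simp [projDiff_vlift, connMap_vlift]

end Lifts

end TangentBundle

end NatMetric

end

noncomputable section

namespace NatMetric

/-! ### Levi-Civita calculus of a metric on an open subset of a vector space -/

section LocalMetric

variable {E : Type*} [NormedAddCommGroup E] [NormedSpace ℝ E]

/-- `h` is a smooth field of nondegenerate symmetric bilinear forms on the open set `U`. -/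
structure IsMetricOn (h : E → E →L[ℝ] E →L[ℝ] ℝ) (U : Set E) : Prop where
  isOpen : IsOpen U
  contDiffOn : ContDiffOn ℝ ∞ h U
  symm : ∀ u ∈ U, ∀ v w, h u v w = h u w v
  nondegenerate : ∀ u ∈ U, ∀ v, (∀ w, h u v w = 0) → v = 0

/-- The curvature in coordinates as a continuous trilinear map. -/
def curvatureMap (h : E → E →L[ℝ] E →L[ℝ] ℝ) (u : E) : E →L[ℝ] E →L[ℝ] E →L[ℝ] E :=
  (fderiv ℝ (christoffel h) u
      + (ContinuousLinearMap.compL ℝ E E E).bilinearComp (christoffel h u) (christoffel h u))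
    - (fderiv ℝ (christoffel h) u
      + (ContinuousLinearMap.compL ℝ E E E).bilinearComp (christoffel h u) (christoffel h u)).flip

theorem curvatureMap_apply (h : E → E →L[ℝ] E →L[ℝ] ℝ) (u X Y Z : E) :
    curvatureMap h u X Y Z
      = (fderiv ℝ (christoffel h) u X Y Z + christoffel h u X (christoffel h u Y Z))
        - (fderiv ℝ (christoffel h) u Y X Z + christoffel h u Y (christoffel h u X Z)) := by
  simp [curvatureMap]

theorem curvatureMap_antisymm (h : E → E →L[ℝ] E →L[ℝ] ℝ) (u X Y Z : E) :
    curvatureMap h u X Y Z = -curvatureMap h u Y X Z := by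
  simp only [curvatureMap_apply]; abel

theorem curvatureMap_self (h : E → E →L[ℝ] E →L[ℝ] ℝ) (u X Z : E) :
    curvatureMap h u X X Z = 0 := by
  simp [curvatureMap_apply]

theorem fderiv_clm_apply₂ {F : Type*} [NormedAddCommGroup F] [NormedSpace ℝ F]
    {A B : Type*} [NormedAddCommGroup A] [NormedSpace ℝ A] [NormedAddCommGroup B] [NormedSpace ℝ B]
    {f : F → A →L[ℝ] B →L[ℝ] E} {u : F} (hf : DifferentiableAt ℝ f u) (v : A) (w : B) (X : F) :
    fderiv ℝ (fun u' => f u' v w) u X = fderiv ℝ f u X v w := by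
  have h1 : HasFDerivAt (fun u' => f u' v w)
      ((ContinuousLinearMap.apply ℝ E w ∘L ContinuousLinearMap.apply ℝ (B →L[ℝ] E) v)
        ∘L fderiv ℝ f u) u :=
    (ContinuousLinearMap.apply ℝ E w ∘L ContinuousLinearMap.apply ℝ (B →L[ℝ] E) v).hasFDerivAt.comp
      u hf.hasFDerivAt
  rw [h1.fderiv]; simp

theorem contDiffAt_bilinearComp {X A B A' B' : Type*} [NormedAddCommGroup X] [NormedSpace ℝ X]
    [NormedAddCommGroup A] [NormedSpace ℝ A] [NormedAddCommGroup B] [NormedSpace ℝ B]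
    [NormedAddCommGroup A'] [NormedSpace ℝ A'] [NormedAddCommGroup B'] [NormedSpace ℝ B']
    {f : X → A →L[ℝ] B →L[ℝ] E} {S : X → A' →L[ℝ] A} {T : X → B' →L[ℝ] B} {x : X}
    {m : WithTop ℕ∞} (hf : ContDiffAt ℝ m f x) (hS : ContDiffAt ℝ m S x)
    (hT : ContDiffAt ℝ m T x) :
    ContDiffAt ℝ m (fun x => (f x).bilinearComp (S x) (T x)) x :=
  (ContinuousLinearMap.flipₗᵢ ℝ B' A' E).toContinuousLinearEquiv.contDiff.contDiffAt.comp x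
    (((ContinuousLinearMap.flipₗᵢ ℝ A' B E).toContinuousLinearEquiv.contDiff.contDiffAt.comp x
      (hf.clm_comp hS)).clm_comp hT)

namespace IsMetricOn

variable {h : E → E →L[ℝ] E →L[ℝ] ℝ} {U : Set E} {u : E}

theorem contDiffAt (hh : IsMetricOn h U) (hu : u ∈ U) : ContDiffAt ℝ ∞ h u :=
  hh.contDiffOn.contDiffAt (hh.isOpen.mem_nhds hu)

theorem differentiableAt (hh : IsMetricOn h U) (hu : u ∈ U) : DifferentiableAt ℝ h u :=
  (hh.contDiffAt hu).differentiableAt (by simp)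

theorem eventually_mem (hh : IsMetricOn h U) (hu : u ∈ U) : ∀ᶠ u' in nhds u, u' ∈ U :=
  hh.isOpen.mem_nhds hu

theorem ext_left (hh : IsMetricOn h U) (hu : u ∈ U) {v w : E} (H : ∀ z, h u v z = h u w z) :
    v = w :=
  sub_eq_zero.1 (hh.nondegenerate u hu _ fun z => by simp [H z])

theorem fderiv_symm (hh : IsMetricOn h U) (hu : u ∈ U) (z v w : E) :
    fderiv ℝ h u z v w = fderiv ℝ h u z w v := by
  rw [← fderiv_clm_apply₂ (hh.differentiableAt hu), ← fderiv_clm_apply₂ (hh.differentiableAt hu)]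
  congr 1
  exact Filter.EventuallyEq.fderiv_eq ((hh.eventually_mem hu).mono fun u' hu' => hh.symm u' hu' v w)

theorem contDiffAt_fderiv (hh : IsMetricOn h U) (hu : u ∈ U) : ContDiffAt ℝ ∞ (fderiv ℝ h) u :=
  (hh.contDiffAt hu).fderiv_right (m := ∞) (by simp)

theorem christoffelFirst_eq : christoffelFirst h = fun u =>
    (1 / 2 : ℝ) • (fderiv ℝ h u + ContinuousLinearMap.flipₗᵢ ℝ E E (E →L[ℝ] ℝ) (fderiv ℝ h u)
    - ContinuousLinearMap.compL ℝ E _ _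
        (ContinuousLinearMap.flipₗᵢ ℝ E E ℝ : (E →L[ℝ] E →L[ℝ] ℝ) →L[ℝ] (E →L[ℝ] E →L[ℝ] ℝ))
      (ContinuousLinearMap.flipₗᵢ ℝ E E (E →L[ℝ] ℝ) (fderiv ℝ h u))) := rfl

set_option synthInstance.maxHeartbeats 200000 in
theorem contDiffAt_christoffelFirst (hh : IsMetricOn h U) (hu : u ∈ U) :
    ContDiffAt ℝ ∞ (christoffelFirst h) u := by
  have h1 := hh.contDiffAt_fderiv hu
  have h2 : ContDiffAt ℝ ∞ (fun u =>
      ContinuousLinearMap.flipₗᵢ ℝ E E (E →L[ℝ] ℝ) (fderiv ℝ h u)) u :=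
    (ContinuousLinearMap.flipₗᵢ ℝ E E (E →L[ℝ] ℝ)).toContinuousLinearEquiv.contDiff.contDiffAt.comp
      u h1
  rw [christoffelFirst_eq]
  exact ((h1.add h2).sub ((ContinuousLinearMap.contDiff _).contDiffAt.comp u h2)).const_smul _

theorem christoffelFirst_symm (hh : IsMetricOn h U) (hu : u ∈ U) (v w : E) :
    christoffelFirst h u v w = christoffelFirst h u w v := by
  ext z
  rw [christoffelFirst_apply, christoffelFirst_apply, hh.fderiv_symm hu z v w]; ring

theorem christoffel_symm (hh : IsMetricOn h U) (hu : u ∈ U) (v w : E) :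
    christoffel h u v w = christoffel h u w v := by
  rw [christoffel_apply, christoffel_apply, hh.christoffelFirst_symm hu]

variable [FiniteDimensional ℝ E]

theorem exists_equiv (hh : IsMetricOn h U) (hu : u ∈ U) :
    ∃ e : E ≃L[ℝ] (E →L[ℝ] ℝ), (e : E →L[ℝ] (E →L[ℝ] ℝ)) = h u := by
  have inj : Function.Injective (h u).toLinearMap := by
    rw [← LinearMap.ker_eq_bot, LinearMap.ker_eq_bot']
    intro v hv
    refine hh.nondegenerate u hu v fun w => ?_
    exact DFunLike.congr_fun hv w
  have hdim : Module.finrank ℝ E = Module.finrank ℝ (E →L[ℝ] ℝ) := by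
    rw [← LinearEquiv.finrank_eq (LinearMap.toContinuousLinearMap (𝕜 := ℝ) (E := E) (F' := ℝ))]
    exact (Subspace.dual_finrank_eq (K := ℝ) (V := E)).symm
  refine ⟨(LinearEquiv.ofInjectiveOfFinrankEq (h u).toLinearMap inj
    hdim).toContinuousLinearEquiv, ?_⟩
  ext v w; rfl

theorem apply_inverse (hh : IsMetricOn h U) (hu : u ∈ U) (θ : E →L[ℝ] ℝ) :
    h u ((h u).inverse θ) = θ := by
  obtain ⟨e, he⟩ := hh.exists_equiv hu
  rw [← he]; simp

theorem apply_christoffel (hh : IsMetricOn h U) (hu : u ∈ U) (v w z : E) :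
    h u (christoffel h u v w) z = christoffelFirst h u v w z := by
  rw [christoffel_apply, hh.apply_inverse hu]

theorem eq_christoffel (hh : IsMetricOn h U) (hu : u ∈ U) {v w x : E}
    (H : ∀ z, christoffelFirst h u v w z = h u x z) : christoffel h u v w = x :=
  hh.ext_left hu fun z => by rw [hh.apply_christoffel hu, H]

theorem contDiffAt_christoffel (hh : IsMetricOn h U) (hu : u ∈ U) :
    ContDiffAt ℝ ∞ (christoffel h) u := by
  obtain ⟨e, he⟩ := hh.exists_equiv hu
  have h1 : ContDiffAt ℝ ∞ (fun u => (h u).inverse) u := by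
    refine ContDiffAt.comp u (g := ContinuousLinearMap.inverse) ?_ (hh.contDiffAt hu)
    rw [← he]; exact contDiffAt_map_inverse e
  have h2 := hh.contDiffAt_christoffelFirst hu
  exact ((ContinuousLinearMap.contDiff
    (ContinuousLinearMap.compL ℝ E (E →L[ℝ] ℝ) E)).contDiffAt.comp u h1).clm_comp h2

theorem differentiableAt_christoffel (hh : IsMetricOn h U) (hu : u ∈ U) :
    DifferentiableAt ℝ (christoffel h) u :=
  (hh.contDiffAt_christoffel hu).differentiableAt (by simp)

theorem contDiffAt_fderiv_christoffel (hh : IsMetricOn h U) (hu : u ∈ U) :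
    ContDiffAt ℝ ∞ (fderiv ℝ (christoffel h)) u :=
  (hh.contDiffAt_christoffel hu).fderiv_right (m := ∞) (by simp)

theorem fderiv_christoffel_symm (hh : IsMetricOn h U) (hu : u ∈ U) (z v w : E) :
    fderiv ℝ (christoffel h) u z v w = fderiv ℝ (christoffel h) u z w v := by
  rw [← fderiv_clm_apply₂ (hh.differentiableAt_christoffel hu),
    ← fderiv_clm_apply₂ (hh.differentiableAt_christoffel hu)]
  congr 1
  exact Filter.EventuallyEq.fderiv_eq
    ((hh.eventually_mem hu).mono fun u' hu' => hh.christoffel_symm hu' v w)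

theorem coordCurvature_eq (hh : IsMetricOn h U) (hu : u ∈ U) (X Y Z : E) :
    coordCurvature h u X Y Z = curvatureMap h u X Y Z := by
  rw [coordCurvature, curvatureMap_apply, fderiv_clm_apply₂ (hh.differentiableAt_christoffel hu),
    fderiv_clm_apply₂ (hh.differentiableAt_christoffel hu)]

theorem contDiffAt_curvatureMap (hh : IsMetricOn h U) (hu : u ∈ U) :
    ContDiffAt ℝ ∞ (curvatureMap h) u := by
  have h1 := hh.contDiffAt_christoffel hu
  have h2 := hh.contDiffAt_fderiv_christoffel hu
  have h3 : ContDiffAt ℝ ∞ (fun u => fderiv ℝ (christoffel h) u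
      + (ContinuousLinearMap.compL ℝ E E E).bilinearComp (christoffel h u) (christoffel h u)) u := by
    exact h2.add (contDiffAt_bilinearComp contDiffAt_const h1 h1)
  exact h3.sub ((ContinuousLinearMap.flipₗᵢ ℝ E E
    (E →L[ℝ] E)).toContinuousLinearEquiv.contDiff.contDiffAt.comp u h3)

theorem differentiableAt_curvatureMap (hh : IsMetricOn h U) (hu : u ∈ U) :
    DifferentiableAt ℝ (curvatureMap h) u :=
  (hh.contDiffAt_curvatureMap hu).differentiableAt (by simp)

/-- The Levi-Civita connection is metric. -/
theorem fderiv_apply_eq (hh : IsMetricOn h U) (hu : u ∈ U) (z v w : E) :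
    fderiv ℝ h u z v w = h u (christoffel h u z v) w + h u v (christoffel h u z w) := by
  rw [hh.symm u hu v, hh.apply_christoffel hu, hh.apply_christoffel hu, christoffelFirst_apply,
    christoffelFirst_apply, hh.fderiv_symm hu z w v, hh.fderiv_symm hu v z w,
    hh.fderiv_symm hu w z v]
  ring

theorem bianchi (hh : IsMetricOn h U) (hu : u ∈ U) (X Y Z : E) :
    curvatureMap h u X Y Z + curvatureMap h u Y Z X + curvatureMap h u Z X Y = 0 := by
  simp only [curvatureMap_apply]
  rw [hh.fderiv_christoffel_symm hu X Z Y, hh.fderiv_christoffel_symm hu Y X Z,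
    hh.fderiv_christoffel_symm hu Z Y X, hh.christoffel_symm hu Z Y, hh.christoffel_symm hu Z X,
    hh.christoffel_symm hu Y X]
  abel

theorem fderiv_fderiv_apply (hh : IsMetricOn h U) (hu : u ∈ U) (X Y Z T : E) :
    fderiv ℝ (fderiv ℝ h) u X Y Z T
      = h u (fderiv ℝ (christoffel h) u X Y Z + christoffel h u X (christoffel h u Y Z)) T
        + h u (christoffel h u Y Z) (christoffel h u X T)
        + h u (christoffel h u X Z) (christoffel h u Y T)
        + h u Z (fderiv ℝ (christoffel h) u X Y T + christoffel h u X (christoffel h u Y T)) := by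
  have d1 : DifferentiableAt ℝ (fderiv ℝ h) u :=
    (hh.contDiffAt_fderiv hu).differentiableAt (by simp)
  have dh := hh.differentiableAt hu
  have dΓ := hh.differentiableAt_christoffel hu
  have e1 : fderiv ℝ (fun u' => fderiv ℝ h u' Y Z T) u X = fderiv ℝ (fderiv ℝ h) u X Y Z T := by
    have d2 : DifferentiableAt ℝ (fun u' => fderiv ℝ h u' Y) u := d1.clm_apply (by fun_prop)
    rw [fderiv_clm_apply₂ (f := fun u' => fderiv ℝ h u' Y) d2, fderiv_clm_apply d1 (by fun_prop)]
    simp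
  have e2 : ∀ A B : E, HasFDerivAt (fun u' => h u' (christoffel h u' Y A) B)
      ((ContinuousLinearMap.apply ℝ ℝ B) ∘L ((h u) ∘L
        ((ContinuousLinearMap.apply ℝ E A ∘L ContinuousLinearMap.apply ℝ (E →L[ℝ] E) Y)
        ∘L fderiv ℝ (christoffel h) u) + (fderiv ℝ h u).flip (christoffel h u Y A))) u := by
    intro A B
    refine (ContinuousLinearMap.apply ℝ ℝ B).hasFDerivAt.comp u ?_
    refine dh.hasFDerivAt.clm_apply ?_
    exact (ContinuousLinearMap.apply ℝ E A ∘L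
      ContinuousLinearMap.apply ℝ (E →L[ℝ] E) Y).hasFDerivAt.comp u dΓ.hasFDerivAt
  have e3 : (fun u' => fderiv ℝ h u' Y Z T) =ᶠ[nhds u] fun u' =>
      h u' (christoffel h u' Y Z) T + h u' (christoffel h u' Y T) Z :=
    (hh.eventually_mem hu).mono fun u' hu' => by
      simp only
      rw [hh.fderiv_apply_eq hu', hh.symm u' hu' Z]
  rw [← e1, e3.fderiv_eq, ((e2 Z T).fun_add (e2 T Z)).fderiv]
  simp only [add_apply, ContinuousLinearMap.comp_apply,
    ContinuousLinearMap.apply_apply, ContinuousLinearMap.flip_apply, hh.fderiv_apply_eq hu, map_add]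
  rw [hh.symm u hu Z, hh.symm u hu Z, hh.symm u hu (christoffel h u X Z)]
  ring

theorem curvature_skew (hh : IsMetricOn h U) (hu : u ∈ U) (X Y Z T : E) :
    h u (curvatureMap h u X Y Z) T = -h u Z (curvatureMap h u X Y T) := by
  have hs : fderiv ℝ (fderiv ℝ h) u X Y = fderiv ℝ (fderiv ℝ h) u Y X :=
    (hh.contDiffAt hu).isSymmSndFDerivAt (by simpa using WithTop.coe_le_coe.2 (le_top : (2 : ℕ∞) ≤ ⊤)) X Y
  have hs' := congrArg (fun B => B Z T) hs
  simp only [hh.fderiv_fderiv_apply hu] at hs'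
  simp only [curvatureMap_apply, map_sub, map_add, sub_apply,
    add_apply] at hs' ⊢
  linarith

theorem curvature_pair_symm (hh : IsMetricOn h U) (hu : u ∈ U) (X Y Z T : E) :
    h u (curvatureMap h u X Y Z) T = h u (curvatureMap h u Z T X) Y := by
  have B : ∀ A B C D : E, h u (curvatureMap h u A B C) D + h u (curvatureMap h u B C A) D
      + h u (curvatureMap h u C A B) D = 0 := fun A B C D => by
    rw [← add_apply, ← map_add, ← add_apply, ← map_add,
      hh.bianchi hu]; simp
  have S : ∀ A B C D : E, h u (curvatureMap h u A B C) D = -h u (curvatureMap h u A B D) C :=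
    fun A B C D => by rw [hh.curvature_skew hu, hh.symm u hu C]
  have N : ∀ A B C D : E, h u (curvatureMap h u A B C) D = -h u (curvatureMap h u B A C) D :=
    fun A B C D => by rw [curvatureMap_antisymm]; simp
  have b1 := B X Y Z T
  have b2 := B Y Z T X
  have b3 := B Z T X Y
  have b4 := B T X Y Z
  have := S X Y Z T
  have := S Y Z X T
  have := S Z X Y T
  have := S Z T X Y
  have := S T Y Z X
  have := S T X Y Z
  have := N X Z T Y
  have := N Z X Y T
  have := N T Y Z X
  have := N Y T Z X
  have := S X Z T Y
  have := N T X Z Y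
  have := S Y T X Z
  have := S Y T Z X
  linarith

end IsMetricOn

end LocalMetric

end NatMetric

end

noncomputable section

namespace NatMetric

/-! ### The lifted metric in coordinates -/

section Lift

variable {E : Type*} [NormedAddCommGroup E] [NormedSpace ℝ E]

/-- The connection map `dy + Γ(dx, y)` in coordinates. -/
def coordConnMap (h : E → E →L[ℝ] E →L[ℝ] ℝ) (p : E × E) : E × E →L[ℝ] E :=
  ContinuousLinearMap.snd ℝ E E + ((christoffel h p.1).flip p.2) ∘L ContinuousLinearMap.fst ℝ E E

theorem coordConnMap_apply (h : E → E →L[ℝ] E →L[ℝ] ℝ) (p ξ : E × E) :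
    coordConnMap h p ξ = ξ.2 + christoffel h p.1 ξ.1 p.2 := rfl

/-- The coefficients of `a gˢ + b gʰ + c gᵛ` in the coordinates induced by a chart in which the
coefficients of `g` are `h`. -/
def liftMetric (h : E → E →L[ℝ] E →L[ℝ] ℝ) (a b c : ℝ) (p : E × E) :
    E × E →L[ℝ] E × E →L[ℝ] ℝ :=
  a • ((h p.1).bilinearComp (ContinuousLinearMap.fst ℝ E E) (ContinuousLinearMap.fst ℝ E E)
      + (h p.1).bilinearComp (coordConnMap h p) (coordConnMap h p))
    + b • ((h p.1).bilinearComp (ContinuousLinearMap.fst ℝ E E) (coordConnMap h p)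
      + (h p.1).bilinearComp (coordConnMap h p) (ContinuousLinearMap.fst ℝ E E))
    + c • (h p.1).bilinearComp (ContinuousLinearMap.fst ℝ E E) (ContinuousLinearMap.fst ℝ E E)

theorem liftMetric_apply (h : E → E →L[ℝ] E →L[ℝ] ℝ) (a b c : ℝ) (p ξ η : E × E) :
    liftMetric h a b c p ξ η
      = a * (h p.1 ξ.1 η.1 + h p.1 (coordConnMap h p ξ) (coordConnMap h p η))
        + b * (h p.1 ξ.1 (coordConnMap h p η) + h p.1 (coordConnMap h p ξ) η.1)
        + c * h p.1 ξ.1 η.1 := rfl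

/-- The complete lift `(Γ(ζ₁, ξ₁), ∂_y Γ(ζ₁, ξ₁) + Γ(ζ₁, ξ₂) + Γ(ζ₂, ξ₁))` of the Christoffel
symbols to the tangent bundle. -/
def completeLift (h : E → E →L[ℝ] E →L[ℝ] ℝ) (p ζ ξ : E × E) : E × E :=
  (christoffel h p.1 ζ.1 ξ.1, fderiv ℝ (christoffel h) p.1 p.2 ζ.1 ξ.1
    + christoffel h p.1 ζ.1 ξ.2 + christoffel h p.1 ζ.2 ξ.1)

/-- The lift of `T` that is orthogonal to the vertical space. -/
def orthLift (h : E → E →L[ℝ] E →L[ℝ] ℝ) (a b : ℝ) (p : E × E) (T : E) : E × E :=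
  (a • T, -(a • christoffel h p.1 T p.2) - b • T)

variable {h : E → E →L[ℝ] E →L[ℝ] ℝ} {U : Set E} {p : E × E} {a b c : ℝ}

theorem coordConnMap_orthLift (T : E) : coordConnMap h p (orthLift h a b p T) = -(b • T) := by
  simp only [coordConnMap_apply, orthLift, map_smul, smul_apply]
  abel

theorem liftMetric_orthLift (T : E) (η : E × E) :
    liftMetric h a b c p (orthLift h a b p T) η = (a * (a + c) - b ^ 2) * h p.1 T η.1 := by
  rw [liftMetric_apply, coordConnMap_orthLift]
  simp [orthLift]; ring

namespace IsMetricOn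

theorem liftMetric_symm (hh : IsMetricOn h U) (hp : p.1 ∈ U) (ξ η : E × E) :
    liftMetric h a b c p ξ η = liftMetric h a b c p η ξ := by
  simp only [liftMetric_apply]
  rw [hh.symm _ hp ξ.1 η.1, hh.symm _ hp ξ.1 (coordConnMap h p η),
    hh.symm _ hp (coordConnMap h p ξ) (coordConnMap h p η), hh.symm _ hp (coordConnMap h p ξ) η.1]
  ring

theorem liftMetric_nondegenerate (hh : IsMetricOn h U) (hp : p.1 ∈ U)
    (ha : a ≠ 0) (hα : a * (a + c) - b ^ 2 ≠ 0) (ξ : E × E)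
    (H : ∀ η, liftMetric h a b c p ξ η = 0) : ξ = 0 := by
  have h1 : ξ.1 = 0 := by
    refine hh.nondegenerate _ hp _ fun w => ?_
    have := H (orthLift h a b p w)
    rw [hh.liftMetric_symm hp, liftMetric_orthLift, hh.symm _ hp] at this
    exact (mul_eq_zero.1 this).resolve_left hα
  have h2 : ξ.2 = 0 := by
    refine hh.nondegenerate _ hp _ fun w => ?_
    have := H (0, w)
    simpa [liftMetric_apply, coordConnMap_apply, h1, ha] using this
  exact Prod.ext h1 h2

variable [FiniteDimensional ℝ E]

theorem contDiffAt_coordConnMap (hh : IsMetricOn h U) (hp : p.1 ∈ U) :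
    ContDiffAt ℝ ∞ (coordConnMap h) p := by
  have h1 : ContDiffAt ℝ ∞ (fun p : E × E => christoffel h p.1) p :=
    (hh.contDiffAt_christoffel hp).comp p contDiffAt_fst
  have h2 : ContDiffAt ℝ ∞ (fun p : E × E =>
      ContinuousLinearMap.flipₗᵢ ℝ E E E (christoffel h p.1)) p :=
    (ContinuousLinearMap.flipₗᵢ ℝ E E E).toContinuousLinearEquiv.contDiff.contDiffAt.comp p h1
  exact contDiffAt_const.add ((h2.clm_apply contDiffAt_snd).clm_comp contDiffAt_const)

theorem contDiffAt_liftMetric (hh : IsMetricOn h U) (hp : p.1 ∈ U) :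
    ContDiffAt ℝ ∞ (liftMetric h a b c) p := by
  have h1 : ContDiffAt ℝ ∞ (fun p : E × E => h p.1) p := (hh.contDiffAt hp).comp p contDiffAt_fst
  have hK := hh.contDiffAt_coordConnMap hp
  have hf : ContDiffAt ℝ ∞ (fun _ : E × E => ContinuousLinearMap.fst ℝ E E) p := contDiffAt_const
  exact ((((contDiffAt_bilinearComp h1 hf hf).add (contDiffAt_bilinearComp h1 hK hK)).const_smul
    a).add (((contDiffAt_bilinearComp h1 hf hK).add (contDiffAt_bilinearComp h1 hK hf)).const_smul
    b)).add ((contDiffAt_bilinearComp h1 hf hf).const_smul c)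

theorem liftMetric (hh : IsMetricOn h U) (ha : a ≠ 0) (hα : a * (a + c) - b ^ 2 ≠ 0) :
    IsMetricOn (liftMetric h a b c) (U ×ˢ Set.univ) where
  isOpen := hh.isOpen.prod isOpen_univ
  contDiffOn := fun _ hp => (hh.contDiffAt_liftMetric hp.1).contDiffWithinAt
  symm := fun _ hp _ _ => hh.liftMetric_symm hp.1 _ _
  nondegenerate := fun _ hp => hh.liftMetric_nondegenerate hp.1 ha hα

theorem hasFDerivAt_apply_apply (hh : IsMetricOn h U) (hp : p.1 ∈ U) {S T : E × E → E}
    {S' T' : E × E →L[ℝ] E} (hS : HasFDerivAt S S' p) (hT : HasFDerivAt T T' p) :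
    ∃ L : E × E →L[ℝ] ℝ, HasFDerivAt (fun p : E × E => h p.1 (S p) (T p)) L p ∧
      ∀ ζ, L ζ = h p.1 (S' ζ + christoffel h p.1 ζ.1 (S p)) (T p)
        + h p.1 (S p) (T' ζ + christoffel h p.1 ζ.1 (T p)) := by
  have h1 : HasFDerivAt (fun p : E × E => h p.1)
      ((fderiv ℝ h p.1) ∘L ContinuousLinearMap.fst ℝ E E) p :=
    (hh.differentiableAt hp).hasFDerivAt.comp p hasFDerivAt_fst
  refine ⟨_, (h1.clm_apply hS).clm_apply hT, fun ζ => ?_⟩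
  simp [hh.fderiv_apply_eq hp]
  ring

theorem hasFDerivAt_coordConnMap_apply (hh : IsMetricOn h U) (hp : p.1 ∈ U) (ξ : E × E) :
    ∃ L : E × E →L[ℝ] E, HasFDerivAt (fun p : E × E => coordConnMap h p ξ) L p ∧
      ∀ ζ, L ζ + christoffel h p.1 ζ.1 (coordConnMap h p ξ)
        = coordConnMap h p (completeLift h p ζ ξ) + curvatureMap h p.1 ζ.1 p.2 ξ.1 := by
  have h1 : HasFDerivAt (fun p : E × E => christoffel h p.1)
      ((fderiv ℝ (christoffel h) p.1) ∘L ContinuousLinearMap.fst ℝ E E) p :=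
    (hh.differentiableAt_christoffel hp).hasFDerivAt.comp p hasFDerivAt_fst
  refine ⟨_, (hasFDerivAt_const ξ.2 p).add
    ((h1.clm_apply (hasFDerivAt_const ξ.1 p)).clm_apply hasFDerivAt_snd), fun ζ => ?_⟩
  simp only [coordConnMap_apply, completeLift, curvatureMap_apply]
  rw [hh.fderiv_christoffel_symm hp p.2, hh.fderiv_christoffel_symm hp ζ.1 p.2,
    hh.christoffel_symm hp (christoffel h p.1 ζ.1 ξ.1), hh.christoffel_symm hp p.2 ξ.1,
    hh.christoffel_symm hp ζ.2, hh.fderiv_christoffel_symm hp p.2]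
  simp
  abel

/-- The failure of the complete lift to be metric. -/
theorem fderiv_liftMetric (hh : IsMetricOn h U) (hp : p.1 ∈ U) (ζ ξ η : E × E) :
    fderiv ℝ (NatMetric.liftMetric h a b c) p ζ ξ η
      = NatMetric.liftMetric h a b c p (completeLift h p ζ ξ) η
        + NatMetric.liftMetric h a b c p ξ (completeLift h p ζ η)
        + a * (h p.1 (curvatureMap h p.1 ζ.1 p.2 ξ.1) (coordConnMap h p η)
          + h p.1 (coordConnMap h p ξ) (curvatureMap h p.1 ζ.1 p.2 η.1)) := by
  rw [← fderiv_clm_apply₂ ((hh.contDiffAt_liftMetric hp).differentiableAt (by simp))]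
  obtain ⟨Kξ, hKξ, eKξ⟩ := hh.hasFDerivAt_coordConnMap_apply hp ξ
  obtain ⟨Kη, hKη, eKη⟩ := hh.hasFDerivAt_coordConnMap_apply hp η
  have hξ := hasFDerivAt_const (𝕜 := ℝ) ξ.1 p
  have hη := hasFDerivAt_const (𝕜 := ℝ) η.1 p
  obtain ⟨L1, d1, e1⟩ := hh.hasFDerivAt_apply_apply hp hξ hη
  obtain ⟨L2, d2, e2⟩ := hh.hasFDerivAt_apply_apply hp hKξ hKη
  obtain ⟨L3, d3, e3⟩ := hh.hasFDerivAt_apply_apply hp hξ hKη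
  obtain ⟨L4, d4, e4⟩ := hh.hasFDerivAt_apply_apply hp hKξ hη
  have D := (((d1.fun_add d2).const_mul a).fun_add ((d3.fun_add d4).const_mul b)).fun_add
    (d1.const_mul c)
  simp only [liftMetric_apply]
  rw [D.fderiv]
  have hs := hh.curvature_skew hp ζ.1 p.2 ξ.1 η.1
  simp only [add_apply, smul_apply, e1, e2, e3, e4, eKξ, eKη, map_add,
    smul_eq_mul, zero_apply, zero_add]
  simp only [completeLift]
  linear_combination b * hs

theorem christoffelFirst_liftMetric (hh : IsMetricOn h U) (hp : p.1 ∈ U) (ζ ξ η : E × E) :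
    christoffelFirst (NatMetric.liftMetric h a b c) p ζ ξ η
      = NatMetric.liftMetric h a b c p (completeLift h p ζ ξ) η
        + a / 2 * (h p.1 (curvatureMap h p.1 ζ.1 p.2 ξ.1 + curvatureMap h p.1 ξ.1 p.2 ζ.1)
            (coordConnMap h p η)
          + h p.1 (curvatureMap h p.1 p.2 (coordConnMap h p ξ) ζ.1
            + curvatureMap h p.1 p.2 (coordConnMap h p ζ) ξ.1) η.1) := by
  have hB : ∀ ζ ξ : E × E, completeLift h p ζ ξ = completeLift h p ξ ζ := fun ζ ξ => by
    simp only [completeLift]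
    rw [hh.christoffel_symm hp ζ.1 ξ.1, hh.fderiv_christoffel_symm hp p.2 ζ.1,
      hh.christoffel_symm hp ζ.1 ξ.2, hh.christoffel_symm hp ζ.2]
    simp only [Prod.mk.injEq, true_and]
    abel
  have key : ∀ A B K : E, h p.1 K (curvatureMap h p.1 A p.2 B) - h p.1 K (curvatureMap h p.1 B p.2 A)
      = h p.1 (curvatureMap h p.1 p.2 K A) B := fun A B K => by
    have hb := congrArg (h p.1 K) (hh.bianchi hp A p.2 B)
    rw [← hh.curvature_pair_symm hp A B, hh.symm _ hp _ K]
    rw [curvatureMap_antisymm h p.1 p.2 B, curvatureMap_antisymm h p.1 B A] at hb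
    simp only [map_add, map_neg, map_zero] at hb
    linarith
  rw [christoffelFirst_apply, hh.fderiv_liftMetric hp, hh.fderiv_liftMetric hp,
    hh.fderiv_liftMetric hp, hB ξ ζ, hB η ζ, hB η ξ,
    hh.liftMetric_symm hp (completeLift h p ζ η) ξ, hh.symm _ hp (curvatureMap h p.1 η.1 p.2 ζ.1)]
  simp only [map_add, add_apply]
  rw [← key, ← key]
  ring

theorem christoffel_liftMetric_vertical (hh : IsMetricOn h U) (hp : p.1 ∈ U) (ha : a ≠ 0)
    (hα : a * (a + c) - b ^ 2 ≠ 0) (ξ : E × E) (Z : E) :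
    christoffel (NatMetric.liftMetric h a b c) p ξ (0, Z)
      = (0, christoffel h p.1 ξ.1 Z) - (a / (2 * (a * (a + c) - b ^ 2))) •
        orthLift h a b p (curvatureMap h p.1 Z p.2 ξ.1) := by
  refine (hh.liftMetric ha hα).eq_christoffel (Set.mk_mem_prod hp trivial) fun η => ?_
  rw [hh.christoffelFirst_liftMetric hp, map_sub, map_smul, sub_apply,
    smul_apply, liftMetric_orthLift, curvatureMap_antisymm h p.1 Z]
  simp [completeLift, coordConnMap_apply]
  field_simp

theorem christoffel_liftMetric_of_flat (hh : IsMetricOn h U) (hp : p.1 ∈ U) (ha : a ≠ 0)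
    (hα : a * (a + c) - b ^ 2 ≠ 0) (hR : curvatureMap h p.1 = 0) (ζ ξ : E × E) :
    christoffel (NatMetric.liftMetric h a b c) p ζ ξ = completeLift h p ζ ξ := by
  refine (hh.liftMetric ha hα).eq_christoffel (Set.mk_mem_prod hp trivial) fun η => ?_
  rw [hh.christoffelFirst_liftMetric hp, hR]
  simp

end IsMetricOn

end Lift

end NatMetric

end

noncomputable section

namespace NatMetric

/-! ### Curvature of the lifted metric -/

section LiftCurvature

variable {E : Type*} [NormedAddCommGroup E] [NormedSpace ℝ E]

theorem fst_fderiv_vertical {F : E × E → E × E} {p : E × E} (hF : DifferentiableAt ℝ F p) (Y : E) :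
    (fderiv ℝ F p (0, Y)).1 = fderiv ℝ (fun v => (F (p.1, v)).1) p.2 Y := by
  have h1 : HasFDerivAt (fun v : E => (p.1, v)) (ContinuousLinearMap.inr ℝ E E) p.2 :=
    hasFDerivAt_prodMk_right p.1 p.2
  have h2 : HasFDerivAt (fun v => (F (p.1, v)).1)
      (ContinuousLinearMap.fst ℝ E E ∘L (fderiv ℝ F p ∘L ContinuousLinearMap.inr ℝ E E)) p.2 :=
    (ContinuousLinearMap.fst ℝ E E).hasFDerivAt.comp p.2
      (HasFDerivAt.comp (g := F) p.2 hF.hasFDerivAt h1)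
  rw [h2.fderiv]; simp

variable [FiniteDimensional ℝ E] {h : E → E →L[ℝ] E →L[ℝ] ℝ} {U : Set E} {p : E × E} {a b c : ℝ}

namespace IsMetricOn

theorem christoffel_liftMetric_vertical_vertical (hh : IsMetricOn h U) (hp : p.1 ∈ U) (ha : a ≠ 0)
    (hα : a * (a + c) - b ^ 2 ≠ 0) (Y Z : E) :
    christoffel (NatMetric.liftMetric h a b c) p (0, Y) (0, Z) = 0 := by
  rw [hh.christoffel_liftMetric_vertical hp ha hα]
  simp [orthLift]

theorem fst_christoffel_liftMetric (hh : IsMetricOn h U) (hp : p.1 ∈ U) (ha : a ≠ 0)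
    (hα : a * (a + c) - b ^ 2 ≠ 0) (ξ : E × E) (Z : E) :
    (christoffel (NatMetric.liftMetric h a b c) p ξ (0, Z)).1
      = -((a ^ 2 / (2 * (a * (a + c) - b ^ 2))) • curvatureMap h p.1 Z p.2 ξ.1) := by
  rw [hh.christoffel_liftMetric_vertical hp ha hα]
  simp only [orthLift, Prod.smul_mk, Prod.fst_sub, zero_sub, smul_smul]
  congr 2
  ring

theorem fderiv_christoffel_liftMetric_vertical_vertical (hh : IsMetricOn h U) (hp : p.1 ∈ U)
    (ha : a ≠ 0) (hα : a * (a + c) - b ^ 2 ≠ 0) (ξ : E × E) (Y Z : E) :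
    fderiv ℝ (christoffel (NatMetric.liftMetric h a b c)) p ξ (0, Y) (0, Z) = 0 := by
  have hG := hh.liftMetric ha hα
  have hp' : p ∈ U ×ˢ (Set.univ : Set E) := ⟨hp, trivial⟩
  rw [← fderiv_clm_apply₂ (hG.differentiableAt_christoffel hp')]
  have : (fun p' => christoffel (NatMetric.liftMetric h a b c) p' (0, Y) (0, Z))
      =ᶠ[nhds p] fun _ => 0 :=
    (hG.eventually_mem hp').mono fun p' hp' =>
      hh.christoffel_liftMetric_vertical_vertical hp'.1 ha hα Y Z
  rw [this.fderiv_eq]; simp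

theorem curvatureMap_liftMetric_vertical (hh : IsMetricOn h U) (hp : p.1 ∈ U)
    (ha : a ≠ 0) (hα : a * (a + c) - b ^ 2 ≠ 0) (X Y Z : E) :
    curvatureMap (NatMetric.liftMetric h a b c) p (0, X) (0, Y) (0, Z) = 0 := by
  rw [curvatureMap_apply]
  simp [hh.fderiv_christoffel_liftMetric_vertical_vertical hp ha hα,
    hh.christoffel_liftMetric_vertical_vertical hp ha hα]

theorem liftMetric_curvatureMap_vertical (hh : IsMetricOn h U) (hp : p.1 ∈ U)
    (ha : a ≠ 0) (hα : a * (a + c) - b ^ 2 ≠ 0) (ξ : E × E) (Y Z W : E) :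
    NatMetric.liftMetric h a b c p
      (curvatureMap (NatMetric.liftMetric h a b c) p ξ (0, Y) (0, Z)) (0, W) = 0 := by
  have hG := hh.liftMetric ha hα
  have hp' : p ∈ U ×ˢ (Set.univ : Set E) := ⟨hp, trivial⟩
  rw [hG.curvature_pair_symm hp', hG.curvature_skew hp',
    hh.curvatureMap_liftMetric_vertical hp ha hα]
  simp

theorem fst_curvatureMap_liftMetric (hh : IsMetricOn h U) (hp : p.1 ∈ U)
    (ha : a ≠ 0) (hα : a * (a + c) - b ^ 2 ≠ 0) (ξ : E × E) (Y Z : E) {k : ℝ}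
    (hk : k = a ^ 2 / (2 * (a * (a + c) - b ^ 2))) :
    (curvatureMap (NatMetric.liftMetric h a b c) p ξ (0, Y) (0, Z)).1
      = k • curvatureMap h p.1 Z Y ξ.1
        - k ^ 2 • curvatureMap h p.1 Y p.2 (curvatureMap h p.1 Z p.2 ξ.1) := by
  have hG := hh.liftMetric ha hα
  have hp' : p ∈ U ×ˢ (Set.univ : Set E) := ⟨hp, trivial⟩
  have dΓ := hG.differentiableAt_christoffel hp'
  rw [curvatureMap_apply, hh.fderiv_christoffel_liftMetric_vertical_vertical hp ha hα,
    hh.christoffel_liftMetric_vertical_vertical hp ha hα, map_zero, zero_add, zero_sub,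
    Prod.fst_neg, Prod.fst_add, hG.christoffel_symm hp' (0, Y),
    hh.fst_christoffel_liftMetric hp ha hα, hh.fst_christoffel_liftMetric hp ha hα,
    ← fderiv_clm_apply₂ dΓ, fst_fderiv_vertical (by fun_prop)]
  have e : (fun v => (christoffel (NatMetric.liftMetric h a b c) (p.1, v) ξ (0, Z)).1)
      = ⇑(-(k • (curvatureMap h p.1 Z).flip ξ.1)) := by
    funext v
    rw [hh.fst_christoffel_liftMetric (p := (p.1, v)) hp ha hα, hk]; simp
  rw [e, ContinuousLinearMap.fderiv, ← hk]
  simp [smul_smul, pow_two]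
  abel

theorem fst_coordCovDerivCurvature_liftMetric (hh : IsMetricOn h U) (hp : p.1 ∈ U)
    (ha : a ≠ 0) (hα : a * (a + c) - b ^ 2 ≠ 0) (X W : E) {k : ℝ}
    (hk : k = a ^ 2 / (2 * (a * (a + c) - b ^ 2))) :
    (coordCovDerivCurvature (NatMetric.liftMetric h a b c) p (0, W) (X, 0) (0, p.2) (0, W)).1
      = k ^ 2 • curvatureMap h p.1 W p.2 (curvatureMap h p.1 W p.2 X) := by
  have hG := hh.liftMetric ha hα
  have hp' : p ∈ U ×ˢ (Set.univ : Set E) := ⟨hp, trivial⟩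
  have dR := hG.differentiableAt_curvatureMap hp'
  have e0 : (fun p' => coordCurvature (NatMetric.liftMetric h a b c) p' (X, 0) (0, p.2) (0, W))
      =ᶠ[nhds p]
      fun p' => curvatureMap (NatMetric.liftMetric h a b c) p' (X, 0) (0, p.2) (0, W) :=
    (hG.eventually_mem hp').mono fun p' hp' => hG.coordCurvature_eq hp' _ _ _
  have e1 : (fun v => (curvatureMap (NatMetric.liftMetric h a b c) (p.1, v) (X, 0) (0, p.2)
      (0, W)).1) = fun v => k • curvatureMap h p.1 W p.2 X
        - k ^ 2 • curvatureMap h p.1 p.2 v (curvatureMap h p.1 W v X) := by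
    funext v
    rw [hh.fst_curvatureMap_liftMetric (p := (p.1, v)) hp ha hα _ _ _ hk]
  have d1 : HasFDerivAt (fun v => k • curvatureMap h p.1 W p.2 X
        - k ^ 2 • curvatureMap h p.1 p.2 v (curvatureMap h p.1 W v X)) _ p.2 :=
    (((curvatureMap h p.1 p.2).hasFDerivAt (x := p.2)).clm_apply
      (((curvatureMap h p.1 W).flip X).hasFDerivAt (x := p.2))).const_smul (k ^ 2) |>.const_sub _
  rw [coordCovDerivCurvature, e0.fderiv_eq]
  simp only [hG.coordCurvature_eq hp', hh.christoffel_liftMetric_vertical_vertical hp ha hα,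
    Prod.fst_sub, Prod.fst_add, map_zero, zero_apply, sub_zero]
  rw [fst_fderiv_vertical (by fun_prop), e1, d1.fderiv, hG.christoffel_symm hp' (0, W),
    hG.christoffel_symm hp' (0, W), hh.fst_christoffel_liftMetric hp ha hα,
    hh.fst_curvatureMap_liftMetric hp ha hα _ _ _ hk,
    hh.fst_curvatureMap_liftMetric hp ha hα _ _ _ hk, hh.fst_christoffel_liftMetric hp ha hα, ← hk]
  simp [smul_smul, curvatureMap_self, curvatureMap_antisymm h p.1 p.2 W, pow_two]

/-- If the lifted metric satisfies the condition of weak symmetry along the fibre over `u`, then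
the curvature vanishes at `u`. -/
theorem curvatureMap_eq_zero_of_weaklySymmetric (hh : IsMetricOn h U) {u : E} (hu : u ∈ U)
    (hpos : ∀ v, v ≠ 0 → 0 < h u v v)
    (ha : a ≠ 0) (hα : a * (a + c) - b ^ 2 ≠ 0) (β₁ β₂ : E → E × E → ℝ) (σ : E → E × E)
    (hβ : Filter.Tendsto (fun v => β₂ v (0, v)) (nhds 0) (nhds 0))
    (H : ∀ (v : E) (W X Y Z : E × E),
      coordCovDerivCurvature (NatMetric.liftMetric h a b c) (u, v) W X Y Z
        = β₁ v W • coordCurvature (NatMetric.liftMetric h a b c) (u, v) X Y Z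
          + β₂ v X • coordCurvature (NatMetric.liftMetric h a b c) (u, v) W Y Z
          + β₂ v Y • coordCurvature (NatMetric.liftMetric h a b c) (u, v) X W Z
          + β₂ v Z • coordCurvature (NatMetric.liftMetric h a b c) (u, v) X Y W
          + NatMetric.liftMetric h a b c (u, v)
            (coordCurvature (NatMetric.liftMetric h a b c) (u, v) X Y Z) W • σ v) :
    curvatureMap h u = 0 := by
  have hG := hh.liftMetric ha hα
  obtain ⟨k, hk⟩ : ∃ k, k = a ^ 2 / (2 * (a * (a + c) - b ^ 2)) := ⟨_, rfl⟩
  have hk0 : k ≠ 0 := by rw [hk]; positivity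
  have main : ∀ v W X : E, β₂ v (0, v) ≠ -1 → curvatureMap h u W v X = 0 := by
    intro v W X hv
    have hp' : (u, v) ∈ U ×ˢ (Set.univ : Set E) := ⟨hu, trivial⟩
    have h1 := congrArg Prod.fst (H v (0, W) (X, 0) (0, v) (0, W))
    simp only [hG.coordCurvature_eq hp', hh.curvatureMap_liftMetric_vertical (p := (u, v)) hu ha hα,
      hh.liftMetric_curvatureMap_vertical (p := (u, v)) hu ha hα, Prod.fst_add, Prod.smul_fst,
      hh.fst_curvatureMap_liftMetric (p := (u, v)) hu ha hα _ _ _ hk,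
      hh.fst_coordCovDerivCurvature_liftMetric (p := (u, v)) hu ha hα _ _ hk] at h1
    set A := curvatureMap h u W v with hA
    have hsk : ∀ Y Z, h u (A Y) Z = -h u Y (A Z) := fun Y Z => hh.curvature_skew hu W v Y Z
    have hself : h u (A X) X = 0 := by
      have := hsk X X
      rw [hh.symm u hu X] at this
      linarith
    have h2 := congrArg (fun Z => h u Z X) h1
    simp only [curvatureMap_self, map_add, map_sub, map_smul, map_zero, add_apply,
      sub_apply, smul_apply, zero_apply, smul_eq_mul, hself, hsk (A X) X] at h2
    have h3 : k ^ 2 * (1 + β₂ v (0, v)) * h u (A X) (A X) = 0 := by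
      simp at h2
      linarith
    by_contra hne
    have h4 := (hpos _ hne).ne'
    have h5 : 1 + β₂ v (0, v) ≠ 0 := fun h => hv (by linarith)
    simp_all
  have hev : ∀ᶠ v in nhds (0 : E), β₂ v (0, v) ≠ -1 := hβ.eventually_ne (by norm_num)
  ext W v X
  have hlim : Filter.Tendsto (fun t : ℝ => t • v) (nhdsWithin 0 {0}ᶜ) (nhds 0) := by
    have : Filter.Tendsto (fun t : ℝ => t • v) (nhds 0) (nhds ((0 : ℝ) • v)) :=
      (continuous_id.smul continuous_const).tendsto 0
    rw [zero_smul] at this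
    exact this.mono_left nhdsWithin_le_nhds
  obtain ⟨t, ht, ht0⟩ := ((hlim.eventually hev).and self_mem_nhdsWithin).exists
  have := main (t • v) W X ht
  simpa [show t ≠ 0 from ht0] using this

/-- If the metric is flat near a point, then so is the lifted metric along the fibre. -/
theorem curvatureMap_liftMetric_eq_zero (hh : IsMetricOn h U) (hR : ∀ u ∈ U, curvatureMap h u = 0)
    (hp : p.1 ∈ U) (ha : a ≠ 0) (hα : a * (a + c) - b ^ 2 ≠ 0) :
    curvatureMap (NatMetric.liftMetric h a b c) p = 0 := by
  have hG := hh.liftMetric ha hα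
  have hp' : p ∈ U ×ˢ (Set.univ : Set E) := ⟨hp, trivial⟩
  have dΓ := hG.differentiableAt_christoffel hp'
  have dγ : HasFDerivAt (fun p : E × E => christoffel h p.1)
      ((fderiv ℝ (christoffel h) p.1) ∘L ContinuousLinearMap.fst ℝ E E) p :=
    (hh.differentiableAt_christoffel hp).hasFDerivAt.comp p hasFDerivAt_fst
  have dγ' : HasFDerivAt (fun p : E × E => fderiv ℝ (christoffel h) p.1)
      ((fderiv ℝ (fderiv ℝ (christoffel h)) p.1) ∘L ContinuousLinearMap.fst ℝ E E) p :=
    ((hh.contDiffAt_fderiv_christoffel hp).differentiableAt (by simp)).hasFDerivAt.comp p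
      hasFDerivAt_fst
  have dL : ∀ ζ ξ η : E × E, fderiv ℝ (christoffel (NatMetric.liftMetric h a b c)) p ζ ξ η
      = (fderiv ℝ (christoffel h) p.1 ζ.1 ξ.1 η.1,
        fderiv ℝ (fderiv ℝ (christoffel h)) p.1 ζ.1 p.2 ξ.1 η.1
          + fderiv ℝ (christoffel h) p.1 ζ.2 ξ.1 η.1 + fderiv ℝ (christoffel h) p.1 ζ.1 ξ.1 η.2
          + fderiv ℝ (christoffel h) p.1 ζ.1 ξ.2 η.1) := by
    intro ζ ξ η
    rw [← fderiv_clm_apply₂ dΓ]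
    have e : (fun p' => christoffel (NatMetric.liftMetric h a b c) p' ξ η)
        =ᶠ[nhds p] fun p' => completeLift h p' ξ η :=
      (hG.eventually_mem hp').mono fun p' hp' =>
        hh.christoffel_liftMetric_of_flat hp'.1 ha hα (hR _ hp'.1) ξ η
    have dγc : ∀ x y : E, HasFDerivAt (fun p : E × E => christoffel h p.1 x y) _ p := fun x y =>
      (dγ.clm_apply (hasFDerivAt_const x p)).clm_apply (hasFDerivAt_const y p)
    have d1 : HasFDerivAt (fun p' => completeLift h p' ξ η) _ p :=
      (dγc ξ.1 η.1).prodMk (((((dγ'.clm_apply hasFDerivAt_snd).clm_apply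
        (hasFDerivAt_const ξ.1 p)).clm_apply (hasFDerivAt_const η.1 p)).add (dγc ξ.1 η.2)).add
        (dγc ξ.2 η.1))
    rw [e.fderiv_eq, d1.fderiv]
    simp
    abel
  have dR : ∀ x y z w : E,
      fderiv ℝ (fderiv ℝ (christoffel h)) p.1 w x y z
        + fderiv ℝ (christoffel h) p.1 w x (christoffel h p.1 y z)
        + christoffel h p.1 x (fderiv ℝ (christoffel h) p.1 w y z)
      = fderiv ℝ (fderiv ℝ (christoffel h)) p.1 w y x z
        + fderiv ℝ (christoffel h) p.1 w y (christoffel h p.1 x z)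
        + christoffel h p.1 y (fderiv ℝ (christoffel h) p.1 w x z) := by
    intro x y z w
    have γ := (hh.differentiableAt_christoffel hp).hasFDerivAt
    have γ' := ((hh.contDiffAt_fderiv_christoffel hp).differentiableAt (by simp)).hasFDerivAt
    have cst : ∀ x : E, HasFDerivAt (fun _ : E => x) (0 : E →L[ℝ] E) p.1 := fun x =>
      hasFDerivAt_const x p.1
    have d : ∀ x y : E, HasFDerivAt (fun u => fderiv ℝ (christoffel h) u x y z
        + christoffel h u x (christoffel h u y z)) _ p.1 := fun x y =>
      (((γ'.clm_apply (cst x)).clm_apply (cst y)).clm_apply (cst z)).add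
        ((γ.clm_apply (cst x)).clm_apply ((γ.clm_apply (cst y)).clm_apply (cst z)))
    have e : (fun u => (fderiv ℝ (christoffel h) u x y z
        + christoffel h u x (christoffel h u y z)) - (fderiv ℝ (christoffel h) u y x z
        + christoffel h u y (christoffel h u x z))) =ᶠ[nhds p.1] fun _ => 0 :=
      (hh.eventually_mem hp).mono fun u hu => by
        simp only
        rw [← curvatureMap_apply, hR u hu]; simp
    have := e.fderiv_eq (𝕜 := ℝ)
    rw [((d x y).fun_sub (d y x)).fderiv] at this
    have := DFunLike.congr_fun this w
    simp at this
    rw [sub_eq_zero] at this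
    rw [add_assoc, add_assoc, add_comm (fderiv ℝ (christoffel h) p.1 w x _), this]
    abel
  have R0 : ∀ x y z, fderiv ℝ (christoffel h) p.1 x y z + christoffel h p.1 x (christoffel h p.1 y z)
      = fderiv ℝ (christoffel h) p.1 y x z + christoffel h p.1 y (christoffel h p.1 x z) := by
    intro x y z
    rw [← sub_eq_zero, ← curvatureMap_apply, hR _ hp]; simp
  have hs : ∀ x y, fderiv ℝ (fderiv ℝ (christoffel h)) p.1 x y
      = fderiv ℝ (fderiv ℝ (christoffel h)) p.1 y x := fun x y =>
    (hh.contDiffAt_christoffel hp).isSymmSndFDerivAt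
      (by simpa using WithTop.coe_le_coe.2 (le_top : (2 : ℕ∞) ≤ ⊤)) x y
  refine ContinuousLinearMap.ext fun ξ => ContinuousLinearMap.ext fun η =>
    ContinuousLinearMap.ext fun ζ => ?_
  rw [curvatureMap_apply, zero_apply, zero_apply, zero_apply, sub_eq_zero]
  simp only [hh.christoffel_liftMetric_of_flat hp ha hα (hR _ hp), dL, completeLift]
  refine Prod.ext (R0 _ _ _) ?_
  simp only [Prod.snd_add, map_add, hs ξ.1 p.2, hs η.1 p.2]
  linear_combination (norm := module) dR ξ.1 η.1 ζ.1 p.2 + R0 ξ.2 η.1 ζ.1 + R0 ξ.1 η.2 ζ.1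
    + R0 ξ.1 η.1 ζ.2

end IsMetricOn

end LiftCurvature

end NatMetric

end

noncomputable section

namespace NatMetric

/-! ### Behaviour under a change of coordinates -/

section Pullback

variable {E : Type*} [NormedAddCommGroup E] [NormedSpace ℝ E]

/-- On the open set `V` the map `ψ` is a smooth local isometry from the metric `h` on `U`
to a second metric. -/
structure IsIsometryOn (h : E → E →L[ℝ] E →L[ℝ] ℝ) (U : Set E) (h' : E → E →L[ℝ] E →L[ℝ] ℝ)
    (U' : Set E) (ψ : E → E) (V : Set E) : Prop where
  source : IsMetricOn h U
  target : IsMetricOn h' U'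
  isOpen : IsOpen V
  subset : V ⊆ U
  mapsTo : Set.MapsTo ψ V U'
  contDiffOn : ContDiffOn ℝ ∞ ψ V
  surjective : ∀ u ∈ V, Function.Surjective (fderiv ℝ ψ u)
  pullback : ∀ u ∈ V, h u = (h' (ψ u)).bilinearComp (fderiv ℝ ψ u) (fderiv ℝ ψ u)

variable {h h' : E → E →L[ℝ] E →L[ℝ] ℝ} {U U' V : Set E} {ψ : E → E} {u : E}

namespace IsIsometryOn

theorem hasFDerivAt (H : IsIsometryOn h U h' U' ψ V) (hu : u ∈ V) :
    HasFDerivAt ψ (fderiv ℝ ψ u) u :=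
  ((H.contDiffOn.contDiffAt (H.isOpen.mem_nhds hu)).differentiableAt (by simp)).hasFDerivAt

theorem contDiffAt_fderiv (H : IsIsometryOn h U h' U' ψ V) (hu : u ∈ V) :
    ContDiffAt ℝ ∞ (fderiv ℝ ψ) u :=
  (H.contDiffOn.contDiffAt (H.isOpen.mem_nhds hu)).fderiv_right (m := ∞) (by simp)

theorem hasFDerivAt_fderiv (H : IsIsometryOn h U h' U' ψ V) (hu : u ∈ V) :
    HasFDerivAt (fderiv ℝ ψ) (fderiv ℝ (fderiv ℝ ψ) u) u :=
  ((H.contDiffAt_fderiv hu).differentiableAt (by simp)).hasFDerivAt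

theorem fderiv_fderiv_symm (H : IsIsometryOn h U h' U' ψ V) (hu : u ∈ V) (v w : E) :
    fderiv ℝ (fderiv ℝ ψ) u v w = fderiv ℝ (fderiv ℝ ψ) u w v :=
  (H.contDiffOn.contDiffAt (H.isOpen.mem_nhds hu)).isSymmSndFDerivAt
    (by simpa using WithTop.coe_le_coe.2 (le_top : (2 : ℕ∞) ≤ ⊤)) v w

theorem fderiv_metric (H : IsIsometryOn h U h' U' ψ V) (hu : u ∈ V) (z v w : E) :
    fderiv ℝ h u z v w
      = fderiv ℝ h' (ψ u) (fderiv ℝ ψ u z) (fderiv ℝ ψ u v) (fderiv ℝ ψ u w)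
        + h' (ψ u) (fderiv ℝ (fderiv ℝ ψ) u z v) (fderiv ℝ ψ u w)
        + h' (ψ u) (fderiv ℝ ψ u v) (fderiv ℝ (fderiv ℝ ψ) u z w) := by
  rw [← fderiv_clm_apply₂ (H.source.differentiableAt (H.subset hu))]
  have e : (fun u' => h u' v w) =ᶠ[nhds u]
      fun u' => h' (ψ u') (fderiv ℝ ψ u' v) (fderiv ℝ ψ u' w) :=
    Filter.eventually_of_mem (H.isOpen.mem_nhds hu) fun u' hu' => by
      simp only [H.pullback u' hu']; rfl
  have d1 : HasFDerivAt (fun u' => h' (ψ u')) _ u :=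
    (H.target.differentiableAt (H.mapsTo hu)).hasFDerivAt.comp u (H.hasFDerivAt hu)
  have d2 : ∀ v : E, HasFDerivAt (fun u' => fderiv ℝ ψ u' v) _ u := fun v =>
    (H.hasFDerivAt_fderiv hu).clm_apply (hasFDerivAt_const v u)
  rw [e.fderiv_eq, ((d1.clm_apply (d2 v)).clm_apply (d2 w)).fderiv]
  simp
  ring

variable [FiniteDimensional ℝ E]

theorem map_christoffel (H : IsIsometryOn h U h' U' ψ V) (hu : u ∈ V) (v w : E) :
    fderiv ℝ ψ u (christoffel h u v w)
      = christoffel h' (ψ u) (fderiv ℝ ψ u v) (fderiv ℝ ψ u w) + fderiv ℝ (fderiv ℝ ψ) u v w := by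
  refine H.target.ext_left (H.mapsTo hu) fun z' => ?_
  obtain ⟨z, rfl⟩ := H.surjective u hu z'
  have e1 : h' (ψ u) (fderiv ℝ ψ u (christoffel h u v w)) (fderiv ℝ ψ u z)
      = h u (christoffel h u v w) z := by
    conv_rhs => rw [H.pullback u hu]
    rfl
  rw [e1, H.source.apply_christoffel (H.subset hu), map_add, add_apply,
    H.target.apply_christoffel (H.mapsTo hu), christoffelFirst_apply, christoffelFirst_apply,
    H.fderiv_metric hu, H.fderiv_metric hu, H.fderiv_metric hu, H.fderiv_fderiv_symm hu w v,
    H.fderiv_fderiv_symm hu z v, H.fderiv_fderiv_symm hu z w,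
    H.target.symm _ (H.mapsTo hu) (fderiv ℝ (fderiv ℝ ψ) u v z)]
  ring

theorem map_fderiv_christoffel (H : IsIsometryOn h U h' U' ψ V) (hu : u ∈ V) (X Y Z : E) :
    fderiv ℝ (fderiv ℝ ψ) u X (christoffel h u Y Z)
      + fderiv ℝ ψ u (fderiv ℝ (christoffel h) u X Y Z)
      = fderiv ℝ (christoffel h') (ψ u) (fderiv ℝ ψ u X) (fderiv ℝ ψ u Y) (fderiv ℝ ψ u Z)
        + christoffel h' (ψ u) (fderiv ℝ (fderiv ℝ ψ) u X Y) (fderiv ℝ ψ u Z)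
        + christoffel h' (ψ u) (fderiv ℝ ψ u Y) (fderiv ℝ (fderiv ℝ ψ) u X Z)
        + fderiv ℝ (fderiv ℝ (fderiv ℝ ψ)) u X Y Z := by
  have e : (fun u' => fderiv ℝ ψ u' (christoffel h u' Y Z)) =ᶠ[nhds u]
      fun u' => christoffel h' (ψ u') (fderiv ℝ ψ u' Y) (fderiv ℝ ψ u' Z)
        + fderiv ℝ (fderiv ℝ ψ) u' Y Z :=
    Filter.eventually_of_mem (H.isOpen.mem_nhds hu) fun u' hu' => H.map_christoffel hu' Y Z
  have cst : ∀ x : E, HasFDerivAt (fun _ : E => x) (0 : E →L[ℝ] E) u := fun x =>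
    hasFDerivAt_const x u
  have dψ := H.hasFDerivAt_fderiv hu
  have dψ2 : HasFDerivAt (fderiv ℝ (fderiv ℝ ψ)) (fderiv ℝ (fderiv ℝ (fderiv ℝ ψ)) u) u :=
    (((H.contDiffAt_fderiv hu).fderiv_right (m := ∞) (by simp)).differentiableAt
      (by simp)).hasFDerivAt
  have dΓ := (H.source.differentiableAt_christoffel (H.subset hu)).hasFDerivAt
  have dΓ' : HasFDerivAt (fun u' => christoffel h' (ψ u')) _ u :=
    (H.target.differentiableAt_christoffel (H.mapsTo hu)).hasFDerivAt.comp u (H.hasFDerivAt hu)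
  have d1 := dψ.clm_apply ((dΓ.clm_apply (cst Y)).clm_apply (cst Z))
  have d2 := ((dΓ'.clm_apply (dψ.clm_apply (cst Y))).clm_apply (dψ.clm_apply (cst Z))).fun_add
    ((dψ2.clm_apply (cst Y)).clm_apply (cst Z))
  have := e.fderiv_eq (𝕜 := ℝ)
  rw [d1.fderiv, d2.fderiv] at this
  have := DFunLike.congr_fun this X
  simp at this
  rw [add_comm, this]
  abel

theorem map_curvatureMap (H : IsIsometryOn h U h' U' ψ V) (hu : u ∈ V) (X Y Z : E) :
    fderiv ℝ ψ u (curvatureMap h u X Y Z)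
      = curvatureMap h' (ψ u) (fderiv ℝ ψ u X) (fderiv ℝ ψ u Y) (fderiv ℝ ψ u Z) := by
  have hs : fderiv ℝ (fderiv ℝ (fderiv ℝ ψ)) u X Y = fderiv ℝ (fderiv ℝ (fderiv ℝ ψ)) u Y X :=
    (H.contDiffAt_fderiv hu).isSymmSndFDerivAt
      (by simpa using WithTop.coe_le_coe.2 (le_top : (2 : ℕ∞) ≤ ⊤)) X Y
  have e1 := H.map_fderiv_christoffel hu X Y Z
  have e2 := H.map_fderiv_christoffel hu Y X Z
  rw [H.fderiv_fderiv_symm hu Y X, ← hs] at e2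
  rw [curvatureMap_apply, curvatureMap_apply]
  simp only [map_add, map_sub, H.map_christoffel hu]
  linear_combination (norm := module) e1 - e2

end IsIsometryOn

end Pullback

end NatMetric

end

noncomputable section

namespace NatMetric

/-! ### Transition maps and the metric in charts -/

section Transition

variable {E : Type*} [NormedAddCommGroup E] [NormedSpace ℝ E]
  {H : Type*} [TopologicalSpace H] (I : ModelWithCorners ℝ E H)
  {N : Type*} [TopologicalSpace N] [ChartedSpace H N]

/-- The change of coordinates from the chart at `x` to the chart at `y`. -/
def transition (x y : N) : E → E := extChartAt I y ∘ (extChartAt I x).symm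

/-- The domain of the change of coordinates. -/
def transitionSource (x y : N) : Set E := ((extChartAt I x).symm ≫ extChartAt I y).source

variable {I} {x y z : N} {u : E}

theorem mem_transitionSource : u ∈ transitionSource I x y ↔
    u ∈ (extChartAt I x).target ∧ (extChartAt I x).symm u ∈ (extChartAt I y).source := by
  simp [transitionSource, PartialEquiv.trans_source]

theorem mem_transitionSource_symm (hu : u ∈ (extChartAt I x).target) :
    u ∈ transitionSource I x ((extChartAt I x).symm u) :=
  mem_transitionSource.2 ⟨hu, mem_extChartAt_source _⟩

theorem transition_mem_target (hu : u ∈ transitionSource I x y) :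
    transition I x y u ∈ (extChartAt I y).target :=
  (extChartAt I y).map_source (mem_transitionSource.1 hu).2

theorem extChartAt_symm_transition (hu : u ∈ transitionSource I x y) :
    (extChartAt I y).symm (transition I x y u) = (extChartAt I x).symm u :=
  (extChartAt I y).left_inv (mem_transitionSource.1 hu).2

theorem transition_transition (hu : u ∈ transitionSource I x y) :
    transition I y z (transition I x y u) = transition I x z u := by
  rw [transition, Function.comp_apply, extChartAt_symm_transition hu]; rfl

theorem transition_mem_transitionSource (hu : u ∈ transitionSource I x y)
    (hz : (extChartAt I x).symm u ∈ (extChartAt I z).source) :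
    transition I x y u ∈ transitionSource I y z := by
  rw [mem_transitionSource, extChartAt_symm_transition hu]
  exact ⟨transition_mem_target hu, hz⟩

theorem isOpen_transitionSource [I.Boundaryless] (x y : N) : IsOpen (transitionSource I x y) := by
  have : transitionSource I x y
      = (extChartAt I x).target ∩ (extChartAt I x).symm ⁻¹' (extChartAt I y).source := by
    ext u; exact mem_transitionSource
  rw [this]
  exact (continuousOn_extChartAt_symm x).isOpen_inter_preimage (isOpen_extChartAt_target x)
    (isOpen_extChartAt_source y)

theorem contDiffOn_transition [IsManifold I ∞ N] (x y : N) :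
    ContDiffOn ℝ ∞ (transition I x y) (transitionSource I x y) :=
  contDiffOn_ext_coord_change y x

variable [I.Boundaryless]

theorem fderiv_transition_self (hu : u ∈ (extChartAt I x).target) :
    fderiv ℝ (transition I x x) u = ContinuousLinearMap.id ℝ E := by
  have : transition I x x =ᶠ[nhds u] id :=
    Filter.eventually_of_mem ((isOpen_extChartAt_target x).mem_nhds hu) fun u' hu' =>
      (extChartAt I x).right_inv hu'
  rw [this.fderiv_eq, fderiv_id]

variable [IsManifold I ∞ N]

theorem differentiableAt_transition (hu : u ∈ transitionSource I x y) :
    DifferentiableAt ℝ (transition I x y) u :=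
  ((contDiffOn_transition x y).contDiffAt
    ((isOpen_transitionSource x y).mem_nhds hu)).differentiableAt (by simp)

theorem fderiv_transition_comp (hu : u ∈ transitionSource I x y)
    (hu' : transition I x y u ∈ transitionSource I y z) (v : E) :
    fderiv ℝ (transition I y z) (transition I x y u) (fderiv ℝ (transition I x y) u v)
      = fderiv ℝ (transition I x z) u v := by
  have e : transition I x z =ᶠ[nhds u] transition I y z ∘ transition I x y :=
    Filter.eventually_of_mem ((isOpen_transitionSource x y).mem_nhds hu) fun u' hu' =>
      (transition_transition hu').symm
  rw [e.fderiv_eq, fderiv_comp u (differentiableAt_transition hu')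
    (differentiableAt_transition hu)]
  rfl

theorem fderiv_transition_symm (hu : u ∈ transitionSource I x y) (v : E) :
    fderiv ℝ (transition I y x) (transition I x y u) (fderiv ℝ (transition I x y) u v) = v := by
  have h1 := (mem_transitionSource.1 hu).1
  rw [fderiv_transition_comp hu
    (transition_mem_transitionSource hu ((extChartAt I x).map_target h1)),
    fderiv_transition_self h1]
  rfl

theorem fderiv_transition_surjective (hu : u ∈ transitionSource I x y) :
    Function.Surjective (fderiv ℝ (transition I x y) u) := fun w => by
  have h1 := (mem_transitionSource.1 hu).1
  have h2 := transition_mem_transitionSource hu ((extChartAt I x).map_target h1)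
  have h3 := fderiv_transition_symm h2 w
  rw [transition_transition hu] at h3
  have h4 : transition I x x u = u := (extChartAt I x).right_inv h1
  rw [h4] at h3
  exact ⟨_, h3⟩

theorem mfderivWithin_extChartAt_symm_eq (hu : u ∈ (extChartAt I x).target) :
    (mfderivWithin 𝓘(ℝ, E) I (extChartAt I x).symm (Set.range I) u : E →L[ℝ] E)
      = fderiv ℝ (transition I x ((extChartAt I x).symm u)) u := by
  have h1 : MDifferentiableWithinAt 𝓘(ℝ, E) I (extChartAt I x).symm (Set.range I) u :=
    mdifferentiableWithinAt_extChartAt_symm hu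
  refine h1.mfderivWithin.trans ?_
  have h2 : (extChartAt 𝓘(ℝ, E) u).symm ⁻¹' Set.range I ∩ Set.range 𝓘(ℝ, E) = Set.univ := by
    simp [I.range_eq_univ]
  rw [h2, ← fderivWithin_univ]
  rfl

theorem chartMetric_apply (h : ∀ x : N, TangentSpace I x →L[ℝ] TangentSpace I x →L[ℝ] ℝ)
    (hu : u ∈ (extChartAt I x).target) (hz : (extChartAt I x).symm u = z) (v w : E) :
    chartMetric h x u v w = (show E →L[ℝ] E →L[ℝ] ℝ from h z)
      (fderiv ℝ (transition I x z) u v) (fderiv ℝ (transition I x z) u w) := by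
  subst hz
  rw [← mfderivWithin_extChartAt_symm_eq hu]
  rfl

theorem chartMetric_transition (h : ∀ x : N, TangentSpace I x →L[ℝ] TangentSpace I x →L[ℝ] ℝ)
    (hu : u ∈ transitionSource I x y) :
    chartMetric h x u = (chartMetric h y (transition I x y u)).bilinearComp
      (fderiv ℝ (transition I x y) u) (fderiv ℝ (transition I x y) u) := by
  ext v w
  have h2 := transition_mem_transitionSource hu (mem_extChartAt_source ((extChartAt I x).symm u))
  rw [ContinuousLinearMap.bilinearComp_apply, chartMetric_apply h (mem_transitionSource.1 hu).1 rfl,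
    chartMetric_apply h (transition_mem_target hu) (extChartAt_symm_transition hu),
    fderiv_transition_comp hu h2, fderiv_transition_comp hu h2]

end Transition

section TangentCharts

variable {E : Type*} [NormedAddCommGroup E] [NormedSpace ℝ E]
  {H : Type*} [TopologicalSpace H] {I : ModelWithCorners ℝ E H}
  {M : Type*} [TopologicalSpace M] [ChartedSpace H M] [IsManifold I ∞ M]

theorem extChartAt_tangent_target (p : TangentBundle I M) :
    (extChartAt I.tangent p).target = (extChartAt I p.proj).target ×ˢ Set.univ := by
  rw [FiberBundle.extChartAt_target]
  congr 1
  refine Set.inter_eq_left.2 fun u hu => ?_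
  have := (extChartAt I p.proj).map_target hu
  rwa [extChartAt_source] at this

variable [I.Boundaryless]

theorem tangentCoordChange_eq (x y z : M) :
    tangentCoordChange I x y z = fderiv ℝ (transition I x y) (extChartAt I x z) := by
  rw [tangentCoordChange_def, I.range_eq_univ, fderivWithin_univ]; rfl

theorem extChartAt_tangent_symm_apply (p : TangentBundle I M) {u : E}
    (hu : u ∈ (extChartAt I p.proj).target) (v : E) :
    (extChartAt I.tangent p).symm (u, v) = ⟨(extChartAt I p.proj).symm u,
      fderiv ℝ (transition I p.proj ((extChartAt I p.proj).symm u)) u v⟩ := by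
  have h1 : (extChartAt I.tangent p).symm (u, v) = ⟨(extChartAt I p.proj).symm u,
      tangentCoordChange I p.proj ((extChartAt I p.proj).symm u)
        ((extChartAt I p.proj).symm u) v⟩ := rfl
  rw [h1, tangentCoordChange_eq, (extChartAt I p.proj).right_inv hu]

theorem transition_tangent (p q : TangentBundle I M) {u : E}
    (hu : u ∈ transitionSource I p.proj q.proj) (v : E) :
    transition I.tangent p q (u, v)
      = (transition I p.proj q.proj u, fderiv ℝ (transition I p.proj q.proj) u v) := by
  have h1 := (mem_transitionSource.1 hu).1
  have h2 := transition_mem_transitionSource (mem_transitionSource_symm h1)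
    (mem_transitionSource.1 hu).2
  rw [transition, Function.comp_apply, extChartAt_tangent_symm_apply p h1]
  have h3 : ∀ Q : TangentBundle I M, extChartAt I.tangent q Q
      = (extChartAt I q.proj Q.proj, tangentCoordChange I Q.proj q.proj Q.proj Q.2) := fun _ => rfl
  rw [h3, tangentCoordChange_eq]
  refine Prod.ext rfl ?_
  exact fderiv_transition_comp (mem_transitionSource_symm h1) h2 v

theorem fderiv_transition_tangent (p q : TangentBundle I M) {u : E}
    (hu : u ∈ transitionSource I p.proj q.proj) (v : E) (ξ : E × E) :
    fderiv ℝ (transition I.tangent p q) (u, v) ξ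
      = (fderiv ℝ (transition I p.proj q.proj) u ξ.1,
        fderiv ℝ (fderiv ℝ (transition I p.proj q.proj)) u ξ.1 v
          + fderiv ℝ (transition I p.proj q.proj) u ξ.2) := by
  set ψ := transition I p.proj q.proj with hψ
  have e : transition I.tangent p q =ᶠ[nhds (u, v)] fun r : E × E => (ψ r.1, fderiv ℝ ψ r.1 r.2) :=
    Filter.eventually_of_mem (((isOpen_transitionSource p.proj q.proj).prod
      isOpen_univ).mem_nhds (Set.mk_mem_prod hu trivial)) fun r hr => transition_tangent p q hr.1 r.2
  have c1 : ContDiffAt ℝ ∞ ψ u := (contDiffOn_transition p.proj q.proj).contDiffAt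
    ((isOpen_transitionSource _ _).mem_nhds hu)
  have d1 : HasFDerivAt (fun r : E × E => ψ r.1) _ (u, v) :=
    HasFDerivAt.comp (g := ψ) (u, v) (c1.differentiableAt (by simp)).hasFDerivAt hasFDerivAt_fst
  have d2 : HasFDerivAt (fun r : E × E => fderiv ℝ ψ r.1) _ (u, v) :=
    HasFDerivAt.comp (g := fderiv ℝ ψ) (u, v)
      ((c1.fderiv_right (m := ∞) (by simp)).differentiableAt (by simp)).hasFDerivAt hasFDerivAt_fst
  rw [e.fderiv_eq, (d1.prodMk (d2.clm_apply hasFDerivAt_snd)).fderiv]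
  simp [add_comm]

end TangentCharts

end NatMetric

end

noncomputable section

namespace NatMetric

/-! ### Riemannian metrics in charts -/

section ChartMetric

variable {E : Type*} [NormedAddCommGroup E] [NormedSpace ℝ E]
  {H : Type*} [TopologicalSpace H] {I : ModelWithCorners ℝ E H} [I.Boundaryless]
  {M : Type*} [TopologicalSpace M] [ChartedSpace H M] [IsManifold I ∞ M]
  (g : Bundle.ContMDiffRiemannianMetric I ∞ E (fun x : M => TangentSpace I x))

theorem contMDiffOn_coordVectorField (x : M) (v : E) :
    ContMDiffOn 𝓘(ℝ, E) I.tangent ∞ (fun u : E => (⟨(extChartAt I x).symm u,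
      fderiv ℝ (transition I x ((extChartAt I x).symm u)) u v⟩ : TangentBundle I M))
      (extChartAt I x).target := by
  let p : TangentBundle I M := ⟨x, 0⟩
  have h1 : ContMDiffOn 𝓘(ℝ, E × E) I.tangent ∞ (extChartAt I.tangent p).symm
      (extChartAt I.tangent p).target := contMDiffOn_extChartAt_symm p
  have h2 : ContMDiffOn 𝓘(ℝ, E) 𝓘(ℝ, E × E) ∞ (fun u : E => (u, v)) (extChartAt I x).target :=
    (contDiff_id.prodMk contDiff_const).contDiffOn.contMDiffOn
  refine (h1.comp h2 fun u hu => ?_).congr fun u hu => ?_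
  · change (u, v) ∈ (extChartAt I.tangent p).target
    rw [extChartAt_tangent_target]
    exact ⟨hu, trivial⟩
  · exact (extChartAt_tangent_symm_apply p hu v).symm

theorem chartMetric_pos (x : M) {u : E} (hu : u ∈ (extChartAt I x).target) (v : E) (hv : v ≠ 0) :
    0 < chartMetric g.inner x u v v := by
  rw [chartMetric_apply g.inner hu rfl]
  refine g.pos _ _ fun h0 => hv ?_
  rw [← fderiv_transition_symm (mem_transitionSource_symm hu) v]
  exact (congrArg _ h0).trans (map_zero _)

variable [FiniteDimensional ℝ E]

theorem contDiffOn_chartMetric (x : M) :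
    ContDiffOn ℝ ∞ (chartMetric g.inner x) (extChartAt I x).target := by
  rw [contDiffOn_clm_apply]
  intro v
  rw [contDiffOn_clm_apply]
  intro w
  rw [← contMDiffOn_iff_contDiffOn]
  intro u hu
  have hb : ContMDiffWithinAt 𝓘(ℝ, E) I ∞ (extChartAt I x).symm (extChartAt I x).target u :=
    contMDiffOn_extChartAt_symm x u hu
  have key : ContMDiffWithinAt 𝓘(ℝ, E) (I.prod 𝓘(ℝ)) ∞
      (fun u' => Bundle.TotalSpace.mk' ℝ (E := Bundle.Trivial M ℝ) ((extChartAt I x).symm u')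
        (g.inner ((extChartAt I x).symm u')
          (fderiv ℝ (transition I x ((extChartAt I x).symm u')) u' v)
          (fderiv ℝ (transition I x ((extChartAt I x).symm u')) u' w)))
        (extChartAt I x).target u := by
    apply ContMDiffWithinAt.clm_bundle_apply₂ (F₁ := E) (F₂ := E)
    · exact ContMDiffAt.comp_contMDiffWithinAt u g.contMDiff.contMDiffAt hb
    · exact contMDiffOn_coordVectorField x v u hu
    · exact contMDiffOn_coordVectorField x w u hu
  simp only [Bundle.contMDiffWithinAt_totalSpace] at key
  exact key.2.congr (fun u' hu' => chartMetric_apply g.inner hu' rfl v w)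
    (chartMetric_apply g.inner hu rfl v w)

theorem isMetricOn_chartMetric (x : M) :
    IsMetricOn (chartMetric g.inner x) (extChartAt I x).target where
  isOpen := isOpen_extChartAt_target x
  contDiffOn := contDiffOn_chartMetric g x
  symm := fun u hu v w => by
    rw [chartMetric_apply g.inner hu rfl, chartMetric_apply g.inner hu rfl]
    exact g.symm _ _ _
  nondegenerate := fun u hu v hv => by
    by_contra h0
    exact (chartMetric_pos g x hu v h0).ne' (hv v)

theorem isIsometryOn_transition (x y : M) :
    IsIsometryOn (chartMetric g.inner x) (extChartAt I x).target
      (chartMetric g.inner y) (extChartAt I y).target (transition I x y)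
      (transitionSource I x y) where
  source := isMetricOn_chartMetric g x
  target := isMetricOn_chartMetric g y
  isOpen := isOpen_transitionSource x y
  subset := fun _ hu => (mem_transitionSource.1 hu).1
  mapsTo := fun _ hu => transition_mem_target hu
  contDiffOn := contDiffOn_transition x y
  surjective := fun _ hu => fderiv_transition_surjective hu
  pullback := fun _ hu => chartMetric_transition g.inner hu

theorem curvatureMap_chartMetric_eq_zero (hg : IsFlat g.inner) (x : M) {u : E}
    (hu : u ∈ (extChartAt I x).target) : curvatureMap (chartMetric g.inner x) u = 0 := by
  have hV := mem_transitionSource_symm hu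
  set y := (extChartAt I x).symm u with hy
  ext X Y Z
  have h1 := (isIsometryOn_transition g x y).map_curvatureMap hV X Y Z
  have h2 : ∀ X Y Z : E, curvatureMap (chartMetric g.inner y) (transition I x y u) X Y Z = 0 := by
    intro X Y Z
    have := hg y X Y Z
    rw [← (isMetricOn_chartMetric g y).coordCurvature_eq (transition_mem_target hV)]
    exact this
  rw [h2] at h1
  rw [← fderiv_transition_symm hV (curvatureMap (chartMetric g.inner x) u X Y Z), h1]
  simp

/-- In the chart of the tangent bundle at `p` the coefficients of `a gˢ + b gʰ + c gᵛ` are given by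
`liftMetric`. -/
theorem chartMetric_natMetric (a b c : ℝ) (p : TangentBundle I M) {u : E}
    (hu : u ∈ (extChartAt I p.proj).target) (v : E) :
    chartMetric (natMetric g.inner a b c) p (u, v)
      = liftMetric (chartMetric g.inner p.proj) a b c (u, v) := by
  refine ContinuousLinearMap.ext fun ξ => ContinuousLinearMap.ext fun η => ?_
  have hV := mem_transitionSource_symm hu
  set y := (extChartAt I p.proj).symm u with hy
  set ψ := transition I p.proj y with hψ
  let q : TangentBundle I M := ⟨y, fderiv ℝ ψ u v⟩
  have hq : (extChartAt I.tangent p).symm (u, v) = q := extChartAt_tangent_symm_apply p hu v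
  have hu' : (u, v) ∈ (extChartAt I.tangent p).target := by
    rw [extChartAt_tangent_target]; exact ⟨hu, trivial⟩
  have hK : ∀ ζ : E × E, connMap g.inner q (fderiv ℝ (transition I.tangent p q) (u, v) ζ)
      = fderiv ℝ ψ u (coordConnMap (chartMetric g.inner p.proj) (u, v) ζ) := by
    intro ζ
    rw [fderiv_transition_tangent p q hV]
    have h1 := (isIsometryOn_transition g p.proj y).map_christoffel hV ζ.1 v
    rw [coordConnMap_apply, map_add, h1]
    change fderiv ℝ (fderiv ℝ ψ) u ζ.1 v + fderiv ℝ ψ u ζ.2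
      + christoffel (chartMetric g.inner y) (extChartAt I y y) (fderiv ℝ ψ u ζ.1) (fderiv ℝ ψ u v)
      = fderiv ℝ ψ u ζ.2 + (christoffel (chartMetric g.inner y) (ψ u) (fderiv ℝ ψ u ζ.1)
        (fderiv ℝ ψ u v) + fderiv ℝ (fderiv ℝ ψ) u ζ.1 v)
    have h2 : ψ u = extChartAt I y y := rfl
    rw [h2]
    abel
  have hπ : ∀ ζ : E × E, projDiff q (fderiv ℝ (transition I.tangent p q) (u, v) ζ)
      = fderiv ℝ ψ u ζ.1 := by
    intro ζ
    rw [fderiv_transition_tangent p q hV]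
    rfl
  have hg : ∀ s t : E, chartMetric g.inner p.proj u s t
      = g.inner y (fderiv ℝ ψ u s) (fderiv ℝ ψ u t) := fun s t =>
    chartMetric_apply g.inner hu rfl s t
  rw [chartMetric_apply _ hu' hq, liftMetric_apply]
  refine (natMetric_apply g.inner a b c q _ _).trans ?_
  rw [hK, hK, hπ, hπ]
  simp only [hg]
  rfl

end ChartMetric

end NatMetric

end

noncomputable section

namespace NatMetric

/-! ### Weak symmetry of the tangent bundle -/

section Congr

variable {E : Type*} [NormedAddCommGroup E] [NormedSpace ℝ E]
  {h h' : E → E →L[ℝ] E →L[ℝ] ℝ} {u : E}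

theorem christoffel_congr (e : h =ᶠ[nhds u] h') : christoffel h =ᶠ[nhds u] christoffel h' := by
  filter_upwards [e, e.fderiv (𝕜 := ℝ)] with u' h1 h2
  rw [christoffel, christoffel, christoffelFirst, christoffelFirst, h1, h2]

theorem coordCurvature_congr (e : h =ᶠ[nhds u] h') :
    coordCurvature h =ᶠ[nhds u] coordCurvature h' := by
  have e1 := christoffel_congr e
  filter_upwards [e1, e1.eventuallyEq_nhds] with u' h1 h2
  funext X Y Z
  have h3 : ∀ A B : E, fderiv ℝ (fun w => christoffel h w A B) u'
      = fderiv ℝ (fun w => christoffel h' w A B) u' := fun A B =>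
    Filter.EventuallyEq.fderiv_eq (h2.fun_comp fun Γ => Γ A B)
  simp only [coordCurvature, h1, h3]

theorem coordCovDerivCurvature_congr (e : h =ᶠ[nhds u] h') :
    coordCovDerivCurvature h u = coordCovDerivCurvature h' u := by
  have e1 := christoffel_congr e
  have e2 := coordCurvature_congr e
  funext W X Y Z
  have h3 : fderiv ℝ (fun w => coordCurvature h w X Y Z) u
      = fderiv ℝ (fun w => coordCurvature h' w X Y Z) u :=
    Filter.EventuallyEq.fderiv_eq (e2.fun_comp fun R => R X Y Z)
  simp only [coordCovDerivCurvature, e1.eq_of_nhds, e2.eq_of_nhds, h3]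

end Congr

section Main

variable {E : Type*} [NormedAddCommGroup E] [NormedSpace ℝ E]
  {H : Type*} [TopologicalSpace H] {I : ModelWithCorners ℝ E H} [I.Boundaryless]
  {M : Type*} [TopologicalSpace M] [ChartedSpace H M] [IsManifold I ∞ M]

/-- A smooth 1-form on the tangent bundle, evaluated on the Liouville field `yⁱ ∂/∂yⁱ` along a
fibre, tends to zero at the zero section. -/
theorem tendsto_oneForm_liouville
    {θ : ∀ p : TangentBundle I M, TangentSpace I.tangent p →L[ℝ] ℝ} (hθ : IsSmoothOneForm θ)
    (x : M) :
    Filter.Tendsto (fun v : E => (show E × E →L[ℝ] ℝ from θ ⟨x, v⟩) (0, v)) (nhds 0) (nhds 0) := by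
  let p : TangentBundle I M := ⟨x, 0⟩
  let P : TangentBundle I.tangent (TangentBundle I M) := ⟨p, 0⟩
  have hb : Continuous (fun v : E => (⟨x, v⟩ : TangentBundle I M)) :=
    FiberBundle.continuous_totalSpaceMk E (fun x : M => TangentSpace I x) x
  have hx := mem_extChartAt_target (I := I) x
  have hmem : ∀ v : E, (extChartAt I x x, v) ∈ (extChartAt I.tangent p).target := fun v => by
    rw [extChartAt_tangent_target]; exact ⟨hx, trivial⟩
  have hp : ∀ v : E, (extChartAt I.tangent p).symm (extChartAt I x x, v) = ⟨x, v⟩ := fun v => by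
    rw [extChartAt_tangent_symm_apply p hx]
    change (⟨(extChartAt I x).symm (extChartAt I x x), fderiv ℝ (transition I x
      ((extChartAt I x).symm (extChartAt I x x))) (extChartAt I x x) v⟩ : TangentBundle I M) = _
    rw [extChartAt_to_inv (I := I) x, fderiv_transition_self hx]
    rfl
  have hV : ContinuousAt (fun v : E => (Bundle.TotalSpace.mk' (E × E) (⟨x, v⟩ : TangentBundle I M)
      ((0, v) : E × E) : TangentBundle I.tangent (TangentBundle I M))) 0 := by
    have h1 : ∀ v : E, (Bundle.TotalSpace.mk' (E × E) (⟨x, v⟩ : TangentBundle I M)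
        ((0, v) : E × E) : TangentBundle I.tangent (TangentBundle I M))
        = (extChartAt I.tangent.tangent P).symm ((extChartAt I x x, v), ((0, v) : E × E)) := by
      intro v
      rw [extChartAt_tangent_symm_apply P (hmem v)]
      change _ = (⟨(extChartAt I.tangent p).symm (extChartAt I x x, v),
        fderiv ℝ (transition I.tangent p ((extChartAt I.tangent p).symm (extChartAt I x x, v)))
          (extChartAt I x x, v) (0, v)⟩ : TangentBundle I.tangent (TangentBundle I M))
      rw [hp v]
      have h2 : transition I.tangent p (⟨x, v⟩ : TangentBundle I M) = transition I.tangent p p := rfl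
      rw [h2, fderiv_transition_self (hmem v)]
      rfl
    simp only [h1]
    have h3 : ContinuousAt (extChartAt I.tangent.tangent P).symm
        ((extChartAt I x x, 0), ((0, 0) : E × E)) := by
      refine (continuousOn_extChartAt_symm P).continuousAt
        ((isOpen_extChartAt_target P).mem_nhds ?_)
      rw [extChartAt_tangent_target]
      exact ⟨hmem 0, trivial⟩
    exact ContinuousAt.comp (f := fun v : E => ((extChartAt I x x, v), ((0, v) : E × E))) h3
      (by fun_prop)
  have hθc : ContinuousAt (fun v : E => Bundle.TotalSpace.mk' (E × E →L[ℝ] ℝ)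
      (E := fun p : TangentBundle I M => TangentSpace I.tangent p →L[ℝ] Bundle.Trivial _ ℝ p)
      (⟨x, v⟩ : TangentBundle I M) (θ ⟨x, v⟩)) 0 :=
    (hθ.continuous.comp hb).continuousAt
  have key := ContinuousAt.clm_bundle_apply (F₁ := E × E) (F₂ := ℝ) hθc hV
  have key2 := (FiberBundle.continuousAt_totalSpace ℝ _).1 key
  have h4 : ContinuousAt (fun v : E => (show E × E →L[ℝ] ℝ from θ ⟨x, v⟩) (0, v)) 0 := key2.2
  exact (map_zero (show E × E →L[ℝ] ℝ from θ ⟨x, 0⟩) : _ = (0 : ℝ)) ▸ h4.tendsto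

theorem extChartAt_tangent_self (x : M) (v : E) :
    extChartAt I.tangent (⟨x, v⟩ : TangentBundle I M) ⟨x, v⟩ = (extChartAt I x x, v) := by
  have h1 : extChartAt I.tangent (⟨x, v⟩ : TangentBundle I M) ⟨x, v⟩ = (extChartAt I x x,
    tangentCoordChange I x x x v) := rfl
  rw [h1, tangentCoordChange_eq, fderiv_transition_self (mem_extChartAt_target _)]
  rfl

variable [FiniteDimensional ℝ E]
  (g : Bundle.ContMDiffRiemannianMetric I ∞ E (fun x : M => TangentSpace I x)) {a b c : ℝ}

theorem chartMetric_natMetric_eventuallyEq (x : M) (v : E) :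
    chartMetric (natMetric g.inner a b c) (⟨x, v⟩ : TangentBundle I M)
      =ᶠ[nhds (extChartAt I x x, v)] liftMetric (chartMetric g.inner x) a b c := by
  let p : TangentBundle I M := ⟨x, v⟩
  rw [← extChartAt_tangent_self]
  filter_upwards [(isOpen_extChartAt_target p).mem_nhds (mem_extChartAt_target p)] with r hr
  rw [extChartAt_tangent_target] at hr
  exact chartMetric_natMetric g a b c p hr.1 r.2

theorem natMetric_eq_liftMetric (x : M) (v : E)
    (ξ η : TangentSpace I.tangent (⟨x, v⟩ : TangentBundle I M)) :
    natMetric g.inner a b c ⟨x, v⟩ ξ η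
      = liftMetric (chartMetric g.inner x) a b c (extChartAt I x x, v) ξ η := by
  let p : TangentBundle I M := ⟨x, v⟩
  have h1 := chartMetric_apply (natMetric g.inner a b c) (mem_extChartAt_target p)
    (extChartAt_to_inv p) ξ η
  rw [fderiv_transition_self (mem_extChartAt_target p), extChartAt_tangent_self,
    (chartMetric_natMetric_eventuallyEq g x v).eq_of_nhds] at h1
  exact h1.symm

theorem curvature_natMetric (x : M) (v : E)
    (X Y Z : TangentSpace I.tangent (⟨x, v⟩ : TangentBundle I M)) :
    curvature (natMetric g.inner a b c) ⟨x, v⟩ X Y Z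
      = coordCurvature (liftMetric (chartMetric g.inner x) a b c) (extChartAt I x x, v) X Y Z := by
  have h1 := (coordCurvature_congr (chartMetric_natMetric_eventuallyEq g (a := a) (b := b) (c := c)
    x v)).eq_of_nhds
  rw [← extChartAt_tangent_self] at h1 ⊢
  exact congrFun (congrFun (congrFun h1 X) Y) Z

theorem covDerivCurvature_natMetric (x : M) (v : E)
    (W X Y Z : TangentSpace I.tangent (⟨x, v⟩ : TangentBundle I M)) :
    covDerivCurvature (natMetric g.inner a b c) ⟨x, v⟩ W X Y Z
      = coordCovDerivCurvature (liftMetric (chartMetric g.inner x) a b c) (extChartAt I x x, v)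
        W X Y Z := by
  have h1 := coordCovDerivCurvature_congr (chartMetric_natMetric_eventuallyEq g (a := a) (b := b)
    (c := c) x v)
  rw [← extChartAt_tangent_self] at h1 ⊢
  exact congrFun (congrFun (congrFun (congrFun h1 W) X) Y) Z

theorem isFlat_of_isWeaklySymmetric_natMetric (ha : a ≠ 0) (hα : a * (a + c) - b ^ 2 ≠ 0)
    (hw : IsWeaklySymmetric (natMetric g.inner a b c)) : IsFlat g.inner := by
  obtain ⟨α₁, α₂, -, h₂, H⟩ := hw
  intro x X Y Z
  have hx := mem_extChartAt_target (I := I) x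
  have hh := isMetricOn_chartMetric g x
  have h0 : curvatureMap (chartMetric g.inner x) (extChartAt I x x) = 0 := by
    refine hh.curvatureMap_eq_zero_of_weaklySymmetric hx
      (chartMetric_pos g x hx) ha hα
      (fun v => show E × E →L[ℝ] ℝ from α₁ ⟨x, v⟩) (fun v => show E × E →L[ℝ] ℝ from α₂ ⟨x, v⟩)
      (fun v => sharp (natMetric g.inner a b c) (⟨x, v⟩ : TangentBundle I M) (α₂ ⟨x, v⟩))
      (tendsto_oneForm_liouville h₂ x)
      fun v (W X Y Z : TangentSpace I.tangent (⟨x, v⟩ : TangentBundle I M)) => ?_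
    have h1 := H ⟨x, v⟩ W X Y Z
    rw [natMetric_eq_liftMetric, covDerivCurvature_natMetric, curvature_natMetric,
      curvature_natMetric, curvature_natMetric, curvature_natMetric] at h1
    exact h1
  refine (hh.coordCurvature_eq hx X Y Z).trans ?_
  rw [h0]
  rfl

theorem coordCurvature_liftMetric_eq_zero (ha : a ≠ 0) (hα : a * (a + c) - b ^ 2 ≠ 0)
    (hg : IsFlat g.inner) (x : M) {r : E × E}
    (hr : r ∈ (extChartAt I x).target ×ˢ (Set.univ : Set E)) (X Y Z : E × E) :
    coordCurvature (liftMetric (chartMetric g.inner x) a b c) r X Y Z = 0 := by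
  have hh := isMetricOn_chartMetric g x
  rw [(hh.liftMetric ha hα).coordCurvature_eq hr, hh.curvatureMap_liftMetric_eq_zero
    (fun u hu => curvatureMap_chartMetric_eq_zero g hg x hu) hr.1 ha hα]
  rfl

theorem isFlat_natMetric (ha : a ≠ 0) (hα : a * (a + c) - b ^ 2 ≠ 0) (hg : IsFlat g.inner) :
    IsFlat (natMetric (I := I) (M := M) g.inner a b c) := by
  rintro ⟨x, v⟩ X Y Z
  exact (curvature_natMetric g x v X Y Z).trans
    (coordCurvature_liftMetric_eq_zero g ha hα hg x ⟨mem_extChartAt_target x, trivial⟩ X Y Z)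

theorem coordCovDerivCurvature_liftMetric_eq_zero (ha : a ≠ 0) (hα : a * (a + c) - b ^ 2 ≠ 0)
    (hg : IsFlat g.inner) (x : M) {r : E × E}
    (hr : r ∈ (extChartAt I x).target ×ˢ (Set.univ : Set E)) (W X Y Z : E × E) :
    coordCovDerivCurvature (liftMetric (chartMetric g.inner x) a b c) r W X Y Z = 0 := by
  have e : (fun r' => coordCurvature (liftMetric (chartMetric g.inner x) a b c) r' X Y Z)
      =ᶠ[nhds r] fun _ => 0 :=
    (((isMetricOn_chartMetric g x).liftMetric ha hα).eventually_mem hr).mono fun r' hr' =>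
      coordCurvature_liftMetric_eq_zero g ha hα hg x hr' X Y Z
  rw [coordCovDerivCurvature, e.fderiv_eq]
  simp [coordCurvature_liftMetric_eq_zero g ha hα hg x hr]

theorem covDerivCurvature_natMetric_eq_zero (ha : a ≠ 0) (hα : a * (a + c) - b ^ 2 ≠ 0)
    (hg : IsFlat g.inner) (p : TangentBundle I M) (W X Y Z : TangentSpace I.tangent p) :
    covDerivCurvature (natMetric g.inner a b c) p W X Y Z = 0 := by
  obtain ⟨x, v⟩ := p
  exact (covDerivCurvature_natMetric g x v W X Y Z).trans
    (coordCovDerivCurvature_liftMetric_eq_zero g ha hα hg x ⟨mem_extChartAt_target x, trivial⟩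
      W X Y Z)

theorem isWeaklySymmetric_natMetric (ha : a ≠ 0) (hα : a * (a + c) - b ^ 2 ≠ 0)
    (hg : IsFlat g.inner) : IsWeaklySymmetric (natMetric (I := I) (M := M) g.inner a b c) := by
  have hz : IsSmoothOneForm (I := I.tangent) (N := TangentBundle I M) fun _ => 0 :=
    Bundle.contMDiff_zeroSection ℝ
      (fun p : TangentBundle I M => TangentSpace I.tangent p →L[ℝ] Bundle.Trivial _ ℝ p)
  refine ⟨fun _ => 0, fun _ => 0, hz, hz, fun p W X Y Z => ?_⟩
  have hf := isFlat_natMetric g ha hα hg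
  rw [covDerivCurvature_natMetric_eq_zero g ha hα hg, hf p X Y Z, hf p W Y Z, hf p X W Z,
    hf p X Y W]
  simp

end Main

end NatMetric

end

theorem stmt_6 {n : ℕ} (hn : 3 ≤ n)
    {M : Type*} [TopologicalSpace M] [ChartedSpace (EuclideanSpace ℝ (Fin n)) M]
    [IsManifold (𝓡 n) ∞ M]
    (g : Bundle.ContMDiffRiemannianMetric (𝓡 n) ∞ (EuclideanSpace ℝ (Fin n))
      (fun x : M => TangentSpace (𝓡 n) x))
    (a b c : ℝ) (ha : 0 < a) (hα : 0 < a * (a + c) - b ^ 2) :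
    (NatMetric.IsWeaklySymmetric (NatMetric.natMetric g.inner a b c) ↔
        NatMetric.IsFlat g.inner) ∧
      (NatMetric.IsWeaklySymmetric (NatMetric.natMetric g.inner a b c) →
        NatMetric.IsFlat (NatMetric.natMetric g.inner a b c)) :=
  ⟨⟨NatMetric.isFlat_of_isWeaklySymmetric_natMetric g ha.ne' hα.ne',
    NatMetric.isWeaklySymmetric_natMetric g ha.ne' hα.ne'⟩,
    fun hw => NatMetric.isFlat_natMetric g ha.ne' hα.ne'
      (NatMetric.isFlat_of_isWeaklySymmetric_natMetric g ha.ne' hα.ne' hw)⟩
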